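/- arXiv:0903.5056 — 3 statements merged into one kernel-verified Lean document; each statement's English description precedes it below -/
import Mathlib

section
/- Let n ≥ 0 be an integer and let p, q ∈ ℝ[x,y] be real polynomials in two variables of total degree at most n. Define I : (0, 1/64) → ℝ by I(t) = ∬_{Δ(t)} (∂q/∂x − ∂p/∂y) dx dy (which by Green's theorem equals the Abelian integral ∮_{δ(t)} (p dx + q dy)). Then the set of isolated zeros of I in the open interval (0, 1/64) is finite, and its cardinality N satisfies 4N ≤ 7n + 36 (i.e. N ≤ (7/4)n + 9). -/
open MeasureTheory Set Filter

/-- The region bounded by the real oval of `{x^2 y (1-x-y) = t}` in the first quadrant. -/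
def Δset (t : ℝ) : Set (ℝ × ℝ) :=
  {z : ℝ × ℝ | 0 < z.1 ∧ 0 < z.2 ∧ t ≤ z.1 ^ 2 * z.2 * (1 - z.1 - z.2)}

/-- The Abelian integral `I_{i,j}(t) = ∬_{Δ(t)} x^i y^j dx dy` (integer powers). -/
noncomputable def Iab (i j : ℤ) (t : ℝ) : ℝ :=
  ∫ z in Δset t, z.1 ^ i * z.2 ^ j

noncomputable def J1 (t : ℝ) : ℝ := Iab 0 0 t
noncomputable def J2 (t : ℝ) : ℝ := Iab 2 0 t
noncomputable def J3 (t : ℝ) : ℝ := Iab 3 0 t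

/-- The Abelian integral of the 1-form `p dx + q dy` over `δ(t)`, written via Green's
theorem as a double integral of `∂q/∂x - ∂p/∂y` over `Δ(t)`. -/
noncomputable def abelInt (p q : MvPolynomial (Fin 2) ℝ) (t : ℝ) : ℝ :=
  ∫ z in Δset t,
    MvPolynomial.eval ![z.1, z.2]
      (MvPolynomial.pderiv (0 : Fin 2) q - MvPolynomial.pderiv (1 : Fin 2) p)

/-- Either `g` vanishes identically on `s`, or it has at most `N` zeros there. -/
def ZerosLE (s : Set ℝ) (g : ℝ → ℝ) (N : ℕ) : Prop :=
  (∀ x ∈ s, g x = 0) ∨ {x | x ∈ s ∧ g x = 0}.Finite ∧ {x | x ∈ s ∧ g x = 0}.ncard ≤ N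

lemma finite_and_ncard_le_of_forall_finset {S : Set ℝ} {N : ℕ}
    (h : ∀ Z : Finset ℝ, (Z : Set ℝ) ⊆ S → Z.card ≤ N) : S.Finite ∧ S.ncard ≤ N := by
  have hfin : S.Finite := by
    by_contra hinf
    obtain ⟨Z, hZ, hcard⟩ := Set.Infinite.exists_subset_card_eq hinf (N + 1)
    have := h Z hZ
    omega
  refine ⟨hfin, ?_⟩
  rw [Set.ncard_eq_toFinset_card S hfin]
  exact h _ (by simp)

namespace ZerosLE

lemma congr {s : Set ℝ} {f g : ℝ → ℝ} {N : ℕ} (h : ZerosLE s f N)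
    (hfg : ∀ x ∈ s, f x = 0 ↔ g x = 0) : ZerosLE s g N := by
  have e : {x | x ∈ s ∧ g x = 0} = {x | x ∈ s ∧ f x = 0} := by
    ext x
    exact and_congr_right fun hx => (hfg x hx).symm
  unfold ZerosLE
  rw [e]
  exact h.imp_left fun h' x hx => (hfg x hx).mp (h' x hx)

lemma mono {s : Set ℝ} {f : ℝ → ℝ} {M N : ℕ} (h : ZerosLE s f M) (hMN : M ≤ N) :
    ZerosLE s f N :=
  h.imp_right fun h' => ⟨h'.1, h'.2.trans hMN⟩

lemma of_hasDerivAt {a b : ℝ} {f f' : ℝ → ℝ} {N : ℕ}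
    (hf : ∀ x ∈ Ioo a b, HasDerivAt f (f' x) x) (h : ZerosLE (Ioo a b) f' N) :
    ZerosLE (Ioo a b) f (N + 1) := by
  rcases h with h0 | ⟨hfin, hcard⟩
  · by_cases hz : ∃ y ∈ Ioo a b, f y = 0
    · left
      obtain ⟨y, hy, hfy⟩ := hz
      intro x hx
      rw [← hfy]
      refine isOpen_Ioo.is_const_of_deriv_eq_zero isPreconnected_Ioo
        (fun z hz => (hf z hz).differentiableAt.differentiableWithinAt) ?_ hx hy
      intro z hz
      simp [(hf z hz).deriv, h0 z hz]
    · right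
      push Not at hz
      have : {x | x ∈ Ioo a b ∧ f x = 0} = ∅ := by
        ext x
        simpa using fun h1 h2 => hz x ⟨h1, h2⟩
      rw [this]
      simp
  · right
    refine finite_and_ncard_le_of_forall_finset fun Z hZ => ?_
    rw [Set.ncard_eq_toFinset_card _ hfin] at hcard
    refine (Finset.card_le_of_interleaved (t := hfin.toFinset) ?_).trans (by omega)
    intro x hx y hy hxy _
    have hx' := hZ hx
    have hy' := hZ hy
    have hsub : Icc x y ⊆ Ioo a b := fun z hz =>
      ⟨hx'.1.1.trans_le hz.1, hz.2.trans_lt hy'.1.2⟩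
    obtain ⟨z, hz, hfz⟩ := exists_hasDerivAt_eq_zero hxy
      (fun z hz => (hf z (hsub hz)).continuousAt.continuousWithinAt) (hx'.2.trans hy'.2.symm)
      (fun z hz => hf z (hsub (Ioo_subset_Icc_self hz)))
    exact ⟨z, by simpa [hfz] using hsub (Ioo_subset_Icc_self hz), hz.1, hz.2⟩

/-- Rolle's theorem for `x ↦ f x / √x`. -/
lemma of_hasDerivAt_div_sqrt {b : ℝ} {f f' : ℝ → ℝ} {N : ℕ}
    (hf : ∀ x ∈ Ioo 0 b, HasDerivAt f (f' x) x)
    (h : ZerosLE (Ioo 0 b) (fun x => f' x - f x / (2 * x)) N) :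
    ZerosLE (Ioo 0 b) f (N + 1) := by
  have hs : ∀ x ∈ Ioo 0 b, √x ≠ 0 := fun x hx => (Real.sqrt_pos.mpr hx.1).ne'
  have key : ∀ x ∈ Ioo 0 b,
      HasDerivAt (fun x => f x / √x) ((f' x - f x / (2 * x)) / √x) x := by
    intro x hx
    refine ((hf x hx).fun_div (Real.hasDerivAt_sqrt hx.1.ne') (hs x hx)).congr_deriv ?_
    have := hs x hx
    rw [show 2 * x = 2 * √x ^ 2 by rw [Real.sq_sqrt hx.1.le]]
    field_simp
  refine (of_hasDerivAt key (h.congr ?_)).congr ?_ <;>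
  · intro x hx
    simp [hs x hx]

end ZerosLE

/-- Rolle's theorem for an inhomogeneous linear equation `F' = r + g F`. -/
lemma exists_eq_zero_of_hasDerivAt_linear {x y : ℝ} (hxy : x < y) {F r g : ℝ → ℝ}
    (hF : ∀ z ∈ Icc x y, HasDerivAt F (r z + g z * F z) z) (hg : ContinuousOn g (Icc x y))
    (hx : F x = 0) (hy : F y = 0) : ∃ z ∈ Ioo x y, r z = 0 := by
  set G := IccExtend hxy.le ((Icc x y).domRestrict g)
  have hG : Continuous G := hg.domRestrict.Icc_extend'
  have hGg : ∀ z ∈ Icc x y, G z = g z := fun z hz => by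
    simp [G, IccExtend_of_mem hxy.le _ hz, Set.domRestrict]
  have hprim : ∀ z, HasDerivAt (fun z => ∫ u in x..z, G u) (G z) z := fun z =>
    intervalIntegral.integral_hasDerivAt_right (hG.intervalIntegrable _ _)
      (hG.stronglyMeasurableAtFilter _ _) hG.continuousAt
  have hd : ∀ z ∈ Icc x y, HasDerivAt (fun z => Real.exp (-∫ u in x..z, G u) * F z)
      (Real.exp (-∫ u in x..z, G u) * r z) z := by
    intro z hz
    refine ((hprim z).fun_neg.exp.fun_mul (hF z hz)).congr_deriv ?_
    rw [hGg z hz]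
    ring
  obtain ⟨z, hz, h0⟩ := exists_hasDerivAt_eq_zero hxy
    (fun z hz => (hd z hz).continuousAt.continuousWithinAt) (by simp [hx, hy])
    (fun z hz => hd z (Ioo_subset_Icc_self hz))
  exact ⟨z, hz, by simpa using h0⟩

open Polynomial in
/-- If `a, f` solve the Picard-Fuchs system and `F = P a + Q f`, then
`X (1 - 16 X) F'` equals `a * riccatiResultant P Q / Q` at the zeros of `F`. -/
noncomputable def riccatiResultant (P Q : ℝ[X]) : ℝ[X] :=
  X * (1 - 16 * X) * (derivative P * Q - P * derivative Q) + X * Q ^ 2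
    + (1 + 8 * X) * P * Q + 5 * P ^ 2

section riccatiResultant

open Polynomial

lemma riccatiResultant_mul (g P Q : ℝ[X]) :
    riccatiResultant (g * P) (g * Q) = g ^ 2 * riccatiResultant P Q := by
  simp only [riccatiResultant, derivative_mul]
  ring

lemma natDegree_X_mul_derivative_le (Q : ℝ[X]) : (X * derivative Q).natDegree ≤ Q.natDegree := by
  rw [natDegree_le_iff_coeff_eq_zero]
  rintro (_ | k) hk
  · simp
  · rw [coeff_X_mul, coeff_derivative, coeff_eq_zero_of_natDegree_lt hk, zero_mul]

lemma coeff_X_mul_derivative (Q : ℝ[X]) (k : ℕ) :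
    (X * derivative Q).coeff k = k * Q.coeff k := by
  rcases k with _ | k
  · simp
  · rw [coeff_X_mul, coeff_derivative]
    push_cast
    ring

/-- The second-order equation that a rational solution of the Riccati equation would impose on its
denominator has no polynomial solution. -/
lemma denominator_equation_false {Q K : ℝ[X]} (hQ : Q ≠ 0)
    (h : (1 - 16 * X) * (1 - 32 * X) * (X * derivative Q)
      + (1 - 16 * X) ^ 2 * (X * derivative (X * derivative Q) - X * derivative Q)
      + (1 - 16 * X) * (X * derivative K) * Q + 5 * X * Q
      + (1 + 8 * X) * ((1 - 16 * X) * (X * derivative Q) + Q * K)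
      + 2 * (1 - 16 * X) * (X * derivative Q) * K + Q * K ^ 2 = 0)
    (h0 : K.eval 0 = 0 ∨ K.eval 0 = -1)
    (h1 : K.eval (1 / 16) = -(1 / 4) ∨ K.eval (1 / 16) = -(5 / 4)) : False := by
  have hQ1 := natDegree_X_mul_derivative_le Q
  have hQ2 := (natDegree_X_mul_derivative_le (X * derivative Q)).trans hQ1
  have hK1 := natDegree_X_mul_derivative_le K
  set q := Q.natDegree with hq
  set Q1 := X * derivative Q with hQ1def
  set Q2 := X * derivative Q1 with hQ2def
  set K1 := X * derivative K with hK1def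
  have hm : (1 - 16 * X : ℝ[X]).natDegree ≤ 1 := by compute_degree
  have hm' : (1 - 32 * X : ℝ[X]).natDegree ≤ 1 := by compute_degree
  have hp : (1 + 8 * X : ℝ[X]).natDegree ≤ 1 := by compute_degree
  have h5 : (5 * X : ℝ[X]).natDegree ≤ 1 := by compute_degree
  have h2m : (2 * (1 - 16 * X) : ℝ[X]).natDegree ≤ 1 := by compute_degree
  have hKdeg : K.natDegree ≤ 1 := by
    by_contra! hc
    set c := K.natDegree with hcdef
    have hK0 : K ≠ 0 := by rintro rfl; simp at hcdef; omega
    have e : Q * K ^ 2 = -((1 - 16 * X) * (1 - 32 * X) * Q1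
      + (1 - 16 * X) ^ 2 * (Q2 - Q1)
      + (1 - 16 * X) * K1 * Q + 5 * X * Q
      + (1 + 8 * X) * ((1 - 16 * X) * Q1 + Q * K)
      + 2 * (1 - 16 * X) * Q1 * K) := by linear_combination h
    have d1 : (Q * K ^ 2).natDegree = q + 2 * c := by
      rw [natDegree_mul hQ (pow_ne_zero _ hK0), natDegree_pow]
    have d2 : (Q * K ^ 2).natDegree ≤ q + c + 1 := by
      rw [e, natDegree_neg]
      have t1 := natDegree_mul_le_of_le (natDegree_mul_le_of_le hm hm') hQ1
      have t2 := natDegree_mul_le_of_le (natDegree_pow_le_of_le 2 hm)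
        (natDegree_sub_le_of_le hQ2 hQ1)
      have t3 := natDegree_mul_le_of_le (natDegree_mul_le_of_le hm hK1) hq.ge
      have t4 := natDegree_mul_le_of_le h5 hq.ge
      have t5 := natDegree_mul_le_of_le hp (natDegree_add_le_of_le
        (natDegree_mul_le_of_le hm hQ1) (natDegree_mul_le_of_le hq.ge hcdef.ge))
      have t6 := natDegree_mul_le_of_le (natDegree_mul_le_of_le h2m hQ1) hcdef.ge
      refine (natDegree_add_le_of_le (natDegree_add_le_of_le (natDegree_add_le_of_le
        (natDegree_add_le_of_le (natDegree_add_le_of_le t1 t2) t3) t4) t5) t6).trans ?_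
      simp only [max_le_iff]
      omega
    omega
  have hKform : K = C (K.coeff 0) + C (K.coeff 1) * X := by
    conv_lhs => rw [eq_X_add_C_of_natDegree_le_one hKdeg]
    ring
  set c0 := K.coeff 0
  set c1 := K.coeff 1
  have lc : Q.coeff q ≠ 0 := by simpa [hq] using hQ
  have cm : (1 - 16 * X : ℝ[X]).coeff 1 = -16 := by
    simp [coeff_one, coeff_ofNat_mul]
  have cm' : (1 - 32 * X : ℝ[X]).coeff 1 = -32 := by
    simp [coeff_one, coeff_ofNat_mul]
  have cp : (1 + 8 * X : ℝ[X]).coeff 1 = 8 := by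
    simp [coeff_one, coeff_ofNat_mul]
  have c2m : (2 * (1 - 16 * X) : ℝ[X]).coeff 1 = -32 := by
    rw [coeff_ofNat_mul, cm]; norm_num
  have cQ1 : Q1.coeff q = q * Q.coeff q := coeff_X_mul_derivative Q q
  have cQ2 : Q2.coeff q = q * (q * Q.coeff q) := by
    rw [hQ2def, coeff_X_mul_derivative, cQ1]
  have cK1 : K1.coeff 1 = c1 := by
    rw [hK1def, coeff_X_mul_derivative]; simp [c1]
  have hK1' := hK1.trans hKdeg
  have key := congrArg (fun p : ℝ[X] => p.coeff (2 + q)) h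
  have t1 : ((1 - 16 * X) * (1 - 32 * X) * Q1).coeff (2 + q) = (-16) * (-32) * (q * Q.coeff q) := by
    rw [coeff_mul_add_eq_of_natDegree_le (natDegree_mul_le_of_le hm hm') hQ1, ← cQ1,
      coeff_mul_add_eq_of_natDegree_le hm hm', cm, cm']
  have t2 : ((1 - 16 * X) ^ 2 * (Q2 - Q1)).coeff (2 + q)
      = 256 * (q * (q * Q.coeff q) - q * Q.coeff q) := by
    have := coeff_mul_add_eq_of_natDegree_le hm hm
    rw [← sq, cm] at this
    have h2 := natDegree_pow_le_of_le 2 hm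
    rw [mul_one] at h2
    rw [coeff_mul_add_eq_of_natDegree_le h2
        ((natDegree_sub_le_of_le hQ2 hQ1).trans (max_le le_rfl le_rfl)),
      coeff_sub, cQ1, cQ2]
    rw [show (2 : ℕ) = 1 + 1 by norm_num, this]
    norm_num
  have t3 : ((1 - 16 * X) * K1 * Q).coeff (2 + q) = -16 * c1 * Q.coeff q := by
    rw [coeff_mul_add_eq_of_natDegree_le (natDegree_mul_le_of_le hm hK1') hq.ge,
      coeff_mul_add_eq_of_natDegree_le hm hK1', cm, cK1]
  have t4 : (5 * X * Q).coeff (2 + q) = 0 :=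
    coeff_eq_zero_of_natDegree_lt ((natDegree_mul_le_of_le h5 hq.ge).trans_lt (by omega))
  have t5 : ((1 + 8 * X) * ((1 - 16 * X) * Q1 + Q * K)).coeff (2 + q)
      = 8 * (-16 * (q * Q.coeff q) + Q.coeff q * c1) := by
    have u1 := natDegree_mul_le_of_le hm hQ1
    have u2 := natDegree_mul_le_of_le hq.ge hKdeg
    rw [show 2 + q = 1 + (1 + q) by ring, coeff_mul_add_eq_of_natDegree_le hp
      ((natDegree_add_le_of_le u1 u2).trans (by omega)), cp, coeff_add,
      coeff_mul_add_eq_of_natDegree_le hm hQ1, add_comm 1 q,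
      coeff_mul_add_eq_of_natDegree_le hq.ge hKdeg,
      cm, cQ1]
  have t6 : (2 * (1 - 16 * X) * Q1 * K).coeff (2 + q) = -32 * (q * Q.coeff q) * c1 := by
    rw [show 2 + q = (1 + q) + 1 by ring,
      coeff_mul_add_eq_of_natDegree_le (natDegree_mul_le_of_le h2m hQ1) hKdeg,
      coeff_mul_add_eq_of_natDegree_le h2m hQ1, c2m, cQ1]
  have t7 : (Q * K ^ 2).coeff (2 + q) = Q.coeff q * (c1 * c1) := by
    have := coeff_mul_add_eq_of_natDegree_le hKdeg hKdeg
    rw [← sq] at this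
    have h2 := natDegree_pow_le_of_le 2 hKdeg
    rw [mul_one] at h2
    rw [add_comm 2 q, coeff_mul_add_eq_of_natDegree_le hq.ge h2,
      show (2 : ℕ) = 1 + 1 by norm_num, this]
  simp only [coeff_add, t1, t2, t3, t4, t5, t6, t7, coeff_zero] at key
  have key2 : (16 * (q : ℝ) - c1) * (16 * q - c1 + 8) = 0 := by
    apply mul_left_cancel₀ lc
    linear_combination key
  rw [hKform] at h0 h1
  simp only [eval_add, eval_mul, eval_C, eval_X] at h0 h1
  have fin : ∀ k : ℤ, c1 = k → k % 8 = 4 → False := by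
    intro k hk hk8
    rw [hk] at key2
    have : (16 * (q : ℤ) - k) * (16 * q - k + 8) = 0 := by exact_mod_cast key2
    rcases mul_eq_zero.mp this with h | h <;> omega
  rcases h0 with h0 | h0 <;> rcases h1 with h1 | h1
  · exact fin (-4) (by push_cast; linarith) (by norm_num)
  · exact fin (-20) (by push_cast; linarith) (by norm_num)
  · exact fin 12 (by push_cast; linarith) (by norm_num)
  · exact fin (-4) (by push_cast; linarith) (by norm_num)

lemma riccatiResultant_ne_zero_of_isCoprime {P Q : ℝ[X]} (hPQ : IsCoprime P Q) (hQ : Q ≠ 0) :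
    riccatiResultant P Q ≠ 0 := by
  intro hR
  rw [riccatiResultant] at hR
  have hdvd : Q ∣ P * (5 * P - X * (1 - 16 * X) * derivative Q) :=
    ⟨-(X * (1 - 16 * X) * derivative P + X * Q + (1 + 8 * X) * P), by linear_combination hR⟩
  obtain ⟨K, hK⟩ := hPQ.symm.dvd_of_dvd_mul_left hdvd
  obtain ⟨u, v, huv⟩ := hPQ
  have nv : ∀ x : ℝ, P.eval x = 0 → Q.eval x = 0 → False := fun x h1 h2 => by
    simpa [h1, h2] using congrArg (eval x) huv
  refine denominator_equation_false (K := K) hQ ?_ ?_ ?_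
  · apply mul_left_cancel₀ hQ
    have hd := congrArg derivative hK
    simp only [derivative_sub, derivative_mul, derivative_X, derivative_one, derivative_ofNat]
      at hd ⊢
    linear_combination 5 * hR - (X * (1 - 16 * X) * Q) * hd
      - (5 * P + (1 + 8 * X) * Q + Q * K) * hK
  · have e0 := congrArg (eval 0) hR
    have k0 := congrArg (eval 0) hK
    simp at e0 k0
    have q0 : Q.eval 0 ≠ 0 := fun hq => nv 0 (by simpa [hq] using e0) hq
    have : P.eval 0 * (Q.eval 0 + 5 * P.eval 0) = 0 := by linear_combination e0
    rcases mul_eq_zero.mp this with h | h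
    · left
      rw [h] at k0
      simpa [q0] using k0
    · right
      apply mul_left_cancel₀ q0
      linear_combination -k0 + h
  · have e0 := congrArg (eval (1 / 16)) hR
    have k0 := congrArg (eval (1 / 16)) hK
    simp only [eval_add, eval_sub, eval_mul, eval_pow, eval_X, eval_one, eval_ofNat, eval_zero]
      at e0 k0
    norm_num at e0 k0
    set x := (1 / 16 : ℝ)
    have q0 : Q.eval x ≠ 0 := fun hq => nv x (by simpa [hq] using e0) hq
    have : (20 * P.eval x + Q.eval x) * (4 * P.eval x + Q.eval x) = 0 := by
      linear_combination 16 * e0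
    rcases mul_eq_zero.mp this with h | h
    · left
      apply mul_left_cancel₀ q0
      linear_combination -k0 + h / 4
    · right
      apply mul_left_cancel₀ q0
      linear_combination -k0 + 5 / 4 * h

lemma riccatiResultant_ne_zero {P Q : ℝ[X]} (h : P ≠ 0 ∨ Q ≠ 0) : riccatiResultant P Q ≠ 0 := by
  rcases eq_or_ne Q 0 with rfl | hQ
  · have hP : P ≠ 0 := by simpa using h
    simp [riccatiResultant, hP]
  · have hg : EuclideanDomain.gcd P Q ≠ 0 := fun h0 => hQ (EuclideanDomain.gcd_eq_zero_iff.mp h0).2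
    obtain ⟨P', hP'⟩ := EuclideanDomain.gcd_dvd_left P Q
    obtain ⟨Q', hQ'⟩ := EuclideanDomain.gcd_dvd_right P Q
    set g := EuclideanDomain.gcd P Q with hgdef
    have hco : IsCoprime P' Q' := by
      refine ⟨EuclideanDomain.gcdA P Q, EuclideanDomain.gcdB P Q, mul_left_cancel₀ hg ?_⟩
      have := EuclideanDomain.gcd_eq_gcd_ab P Q
      rw [← hgdef] at this
      linear_combination -this - EuclideanDomain.gcdA P Q * hP' - EuclideanDomain.gcdB P Q * hQ'
    rw [hP', hQ', riccatiResultant_mul]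
    exact mul_ne_zero (pow_ne_zero _ hg) (riccatiResultant_ne_zero_of_isCoprime hco
      (by rintro rfl; exact hQ (by simpa using hQ')))

lemma natDegree_riccatiResultant_le {P Q : ℝ[X]} {e : ℕ} (hP : P.natDegree ≤ e)
    (hQ : Q.natDegree ≤ e) : (riccatiResultant P Q).natDegree ≤ 2 * e + 2 := by
  have hP' := (natDegree_derivative_le P).trans (Nat.sub_le_of_le_add (hP.trans (Nat.le_succ e)))
  have hQ' := (natDegree_derivative_le Q).trans (Nat.sub_le_of_le_add (hQ.trans (Nat.le_succ e)))
  have hD : (X * (1 - 16 * X) : ℝ[X]).natDegree ≤ 2 := by compute_degree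
  have hp : (1 + 8 * X : ℝ[X]).natDegree ≤ 1 := by compute_degree
  have h5 : (5 : ℝ[X]).natDegree ≤ 0 := by compute_degree
  refine (natDegree_add_le_of_le (natDegree_add_le_of_le (natDegree_add_le_of_le
    (natDegree_mul_le_of_le hD (natDegree_sub_le_of_le (natDegree_mul_le_of_le hP' hQ)
      (natDegree_mul_le_of_le hP hQ')))
    (natDegree_mul_le_of_le natDegree_X_le (natDegree_pow_le_of_le 2 hQ)))
    (natDegree_mul_le_of_le (natDegree_mul_le_of_le hp hP) hQ))
    (natDegree_mul_le_of_le h5 (natDegree_pow_le_of_le 2 hP))).trans ?_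
  simp only [max_le_iff]
  omega

end riccatiResultant

/-- The Picard-Fuchs system of the complete elliptic integrals `a`, `f`, together with the
inhomogeneous equation for the integral `m` of the third kind. -/
structure PicardFuchs (m a f : ℝ → ℝ) : Prop where
  pos : ∀ τ ∈ Ioo (0 : ℝ) (1 / 16), 0 < a τ
  deriv_a : ∀ τ ∈ Ioo (0 : ℝ) (1 / 16),
    HasDerivAt a (((1 - 12 * τ) * a τ - 5 * f τ) / (τ * (1 - 16 * τ))) τ
  deriv_f : ∀ τ ∈ Ioo (0 : ℝ) (1 / 16), HasDerivAt f ((a τ - 20 * f τ) / (1 - 16 * τ)) τ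
  deriv_m : ∀ τ ∈ Ioo (0 : ℝ) (1 / 16),
    HasDerivAt m (m τ / (2 * τ) + (a τ - 20 * f τ) / (2 * (τ * (1 - 16 * τ)))) τ

namespace PicardFuchs

open Polynomial

variable {m a f : ℝ → ℝ}

/-- Zeros of polynomial combinations of `a` and `f`, by the Riccati equation argument. -/
lemma zerosLE_combination (h : PicardFuchs m a f) {P Q : ℝ[X]} {e : ℕ} (hP : P.natDegree ≤ e)
    (hQ : Q.natDegree ≤ e) :
    ZerosLE (Ioo 0 (1 / 16)) (fun τ => P.eval τ * a τ + Q.eval τ * f τ) (3 * e + 3) := by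
  by_cases hPQ : P = 0 ∧ Q = 0
  · left
    simp [hPQ.1, hPQ.2]
  right
  have hR : riccatiResultant P Q ≠ 0 := riccatiResultant_ne_zero (by tauto)
  have hRdeg := natDegree_riccatiResultant_le hP hQ
  set R := riccatiResultant P Q with hRdef
  refine finite_and_ncard_le_of_forall_finset fun Z hZ => ?_
  have hRcard : R.roots.toFinset.card ≤ 2 * e + 2 :=
    (Multiset.toFinset_card_le _).trans ((card_roots' R).trans hRdeg)
  have hQcard : Q.roots.toFinset.card ≤ e :=
    (Multiset.toFinset_card_le _).trans ((card_roots' Q).trans hQ)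
  have hRmem : ∀ x, R.eval x = 0 → x ∈ R.roots.toFinset := fun x hx => by
    simpa [hR] using hx
  have hReval : ∀ x, R.eval x = x * (1 - 16 * x) * ((derivative P).eval x * Q.eval x
      - P.eval x * (derivative Q).eval x) + x * Q.eval x ^ 2
      + (1 + 8 * x) * P.eval x * Q.eval x + 5 * P.eval x ^ 2 := fun x => by
    simp [hRdef, riccatiResultant]
  have hsplit := Finset.card_filter_add_card_filter_not (s := Z) (fun x => Q.eval x = 0)
  have hcommon : ∀ x ∈ Z.filter (fun x => Q.eval x = 0), x ∈ R.roots.toFinset := by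
    intro x hx
    obtain ⟨hxZ, hQx⟩ := Finset.mem_filter.mp hx
    obtain ⟨hxJ, hFx⟩ := hZ hxZ
    have hPx : P.eval x = 0 := by simpa [hQx, (h.pos x hxJ).ne'] using hFx
    exact hRmem x (by simp [hReval, hPx, hQx])
  by_cases hQ0 : Q = 0
  · subst hQ0
    have h1 : Z.filter (fun x => (0 : ℝ[X]).eval x = 0) = Z := by simp
    rw [h1] at hcommon
    exact (Finset.card_le_card hcommon).trans (hRcard.trans (by omega))
  have hQmem : ∀ x, Q.eval x = 0 → x ∈ Q.roots.toFinset := fun x hx => by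
    simpa [hQ0] using hx
  have hinter : (Z.filter (fun x => Q.eval x = 0)).card
      ≤ (R.roots.toFinset ∩ Q.roots.toFinset).card :=
    Finset.card_le_card fun x hx => Finset.mem_inter.mpr
      ⟨hcommon x hx, hQmem x (Finset.mem_filter.mp hx).2⟩
  have hunion : (Z.filter (fun x => ¬ Q.eval x = 0)).card
      ≤ (R.roots.toFinset ∪ Q.roots.toFinset).card + 1 := by
    refine Finset.card_le_of_interleaved ?_
    intro x hx y hy hxy _
    obtain ⟨hxZ, hQx⟩ := Finset.mem_filter.mp hx
    obtain ⟨hyZ, hQy⟩ := Finset.mem_filter.mp hy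
    obtain ⟨hxJ, hFx⟩ := hZ hxZ
    obtain ⟨hyJ, hFy⟩ := hZ hyZ
    by_cases hQz : ∃ z ∈ Ioo x y, Q.eval z = 0
    · obtain ⟨z, hz, hQz⟩ := hQz
      exact ⟨z, Finset.mem_union_right _ (hQmem z hQz), hz.1, hz.2⟩
    push Not at hQz
    have hQne : ∀ z ∈ Icc x y, Q.eval z ≠ 0 := fun z hz => by
      rcases eq_or_lt_of_le hz.1 with rfl | h1
      · exact hQx
      rcases eq_or_lt_of_le hz.2 with rfl | h2
      · exact hQy
      exact hQz z ⟨h1, h2⟩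
    have hJ : ∀ z ∈ Icc x y, z ∈ Ioo (0 : ℝ) (1 / 16) := fun z hz =>
      ⟨hxJ.1.trans_le hz.1, hz.2.trans_lt hyJ.2⟩
    have hne : ∀ z ∈ Icc x y, z ≠ 0 ∧ 1 - 16 * z ≠ 0 := fun z hz =>
      ⟨(hJ z hz).1.ne', by linarith [(hJ z hz).2]⟩
    obtain ⟨z, hz, hrz⟩ : ∃ z ∈ Ioo x y,
        a z * R.eval z / (Q.eval z * (z * (1 - 16 * z))) = 0 := by
      refine exists_eq_zero_of_hasDerivAt_linear hxy
        (F := fun τ => P.eval τ * a τ + Q.eval τ * f τ)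
        (g := fun τ => (τ * (1 - 16 * τ) * (derivative Q).eval τ - 5 * P.eval τ
          - 20 * τ * Q.eval τ) / (Q.eval τ * (τ * (1 - 16 * τ))))
        (fun z hz => ?_) ?_ hFx hFy
      · refine (((P.hasDerivAt z).fun_mul (h.deriv_a z (hJ z hz))).fun_add
          ((Q.hasDerivAt z).fun_mul (h.deriv_f z (hJ z hz)))).congr_deriv ?_
        have h1 := hQne z hz
        obtain ⟨h2, h3⟩ := hne z hz
        rw [hReval]
        obtain ⟨v, hv⟩ : ∃ v, v = 1 - 16 * z := ⟨_, rfl⟩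
        rw [← hv] at h3 ⊢
        field_simp
        rw [hv]
        ring
      · exact ContinuousOn.div (by fun_prop) (by fun_prop) fun z hz =>
          mul_ne_zero (hQne z hz) (mul_ne_zero (hne z hz).1 (hne z hz).2)
    have hzI := Ioo_subset_Icc_self hz
    refine ⟨z, Finset.mem_union_left _ (hRmem z ?_), hz.1, hz.2⟩
    simpa [(h.pos z (hJ z hzI)).ne', hQne z hzI, hne z hzI] using hrz
  have := Finset.card_union_add_card_inter R.roots.toFinset Q.roots.toFinset
  omega

lemma zerosLE_of_degree_lt (h : PicardFuchs m a f) (k : ℕ) :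
    ∀ (i e : ℕ) (α P Q : ℝ[X]), α.degree < k → P.natDegree ≤ e → Q.natDegree ≤ e →
      k + 2 * i ≤ e + 1 →
      ZerosLE (Ioo 0 (1 / 16)) (fun τ => α.eval τ * m τ
        + ((τ * (1 - 16 * τ)) ^ i)⁻¹ * (P.eval τ * a τ + Q.eval τ * f τ))
        (k + 3 * (e + k) + 3) := by
  have hne : ∀ τ ∈ Ioo (0 : ℝ) (1 / 16), τ ≠ 0 ∧ 1 - 16 * τ ≠ 0 := fun τ hτ =>
    ⟨hτ.1.ne', by linarith [hτ.2]⟩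
  induction k with
  | zero =>
    intro i e α P Q hα hP hQ _
    have hα0 : α = 0 := by simpa using hα
    refine ((h.zerosLE_combination hP hQ).congr fun τ hτ => ?_).mono (by omega)
    simp [hα0, hne τ hτ]
  | succ k ih =>
    intro i e α P Q hα hP hQ hkie
    have hα' : (derivative α).degree < k := by
      rcases eq_or_ne α 0 with rfl | hα0
      · simp
      · rw [degree_eq_natDegree hα0, Nat.cast_lt, Nat.lt_succ_iff] at hα
        rcases Nat.eq_zero_or_pos α.natDegree with h0 | h0
        · rw [derivative_of_natDegree_zero h0]
          simp
        · exact degree_le_natDegree.trans_lt (Nat.cast_lt.mpr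
            ((natDegree_derivative_lt h0.ne').trans_le hα))
    have hαk : α.natDegree ≤ k := by
      rw [natDegree_le_iff_degree_le]
      exact Order.le_of_lt_succ (by exact_mod_cast hα)
    set D : ℝ[X] := X * (1 - 16 * X) with hD
    have hDdeg : D.natDegree ≤ 2 := by rw [hD]; compute_degree
    have hDi := natDegree_pow_le_of_le i hDdeg
    have hl : (C (-(i : ℝ)) * (1 - 32 * X) - C (1 / 2) * (1 - 16 * X) : ℝ[X]).natDegree ≤ 1 := by
      compute_degree
    have hdiff : ∀ {S : ℝ[X]}, S.natDegree ≤ e → (D * derivative S).natDegree ≤ e + 1 := by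
      intro S hS
      have h16 : (1 - 16 * X : ℝ[X]).natDegree ≤ 1 := by compute_degree
      have : D * derivative S = (1 - 16 * X) * (X * derivative S) := by rw [hD]; ring
      rw [this, add_comm]
      exact natDegree_mul_le_of_le h16 ((natDegree_X_mul_derivative_le S).trans hS)
    have hadd : ∀ {S T : ℝ[X]}, S.natDegree ≤ e + 1 → T.natDegree ≤ e + 1 →
        (S + T).natDegree ≤ e + 1 := fun hS hT =>
      (natDegree_add_le_of_le hS hT).trans (max_le le_rfl le_rfl)
    have hlin : ∀ {S T : ℝ[X]}, S.natDegree ≤ 1 → T.natDegree ≤ e → (S * T).natDegree ≤ e + 1 :=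
      fun hS hT => (natDegree_mul_le_of_le hS hT).trans (by omega)
    have hαD : ∀ c : ℝ, (C c * α * D ^ i).natDegree ≤ e + 1 := fun c =>
      (natDegree_mul_le_of_le (natDegree_mul_le_of_le (natDegree_C c).le hαk) hDi).trans
        (by omega)
    have key := ih (i + 1) (e + 1) (derivative α)
      ((C (-(i : ℝ)) * (1 - 32 * X) - C (1 / 2) * (1 - 16 * X)) * P + D * derivative P
        + (1 - 12 * X) * P + X * Q + C (1 / 2) * α * D ^ i)
      ((C (-(i : ℝ)) * (1 - 32 * X) - C (1 / 2) * (1 - 16 * X)) * Q + D * derivative Q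
        + (-5) * P + (-20 * X) * Q + C (-10) * α * D ^ i) hα'
      (hadd (hadd (hadd (hadd (hlin hl hP) (hdiff hP)) (hlin (by compute_degree) hP))
        (hlin (by compute_degree) hQ)) (hαD _))
      (hadd (hadd (hadd (hadd (hlin hl hQ) (hdiff hQ)) (hlin (by compute_degree!) hP))
        (hlin (by compute_degree) hQ)) (hαD _)) (by omega)
    refine (ZerosLE.of_hasDerivAt_div_sqrt
      (f' := fun τ => (derivative α).eval τ * m τ + α.eval τ *
          (m τ / (2 * τ) + (a τ - 20 * f τ) / (2 * (τ * (1 - 16 * τ))))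
        + (-(i * (1 - 32 * τ) / (τ * (1 - 16 * τ)) ^ (i + 1))
            * (P.eval τ * a τ + Q.eval τ * f τ)
          + ((τ * (1 - 16 * τ)) ^ i)⁻¹ * ((derivative P).eval τ * a τ
            + P.eval τ * (((1 - 12 * τ) * a τ - 5 * f τ) / (τ * (1 - 16 * τ)))
            + ((derivative Q).eval τ * f τ
              + Q.eval τ * ((a τ - 20 * f τ) / (1 - 16 * τ))))))
      ?_ (key.congr fun τ hτ => ?_)).mono (by omega)
    · intro τ hτ
      obtain ⟨h1, h2⟩ := hne τ hτ
      refine ((α.hasDerivAt τ).fun_mul (h.deriv_m τ hτ)).fun_add (HasDerivAt.fun_mul ?_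
        (((P.hasDerivAt τ).fun_mul (h.deriv_a τ hτ)).fun_add
          ((Q.hasDerivAt τ).fun_mul (h.deriv_f τ hτ))))
      have hDd : HasDerivAt (fun τ : ℝ => τ * (1 - 16 * τ)) (1 - 32 * τ) τ := by
        refine ((hasDerivAt_id' τ).fun_mul
          (((hasDerivAt_id' τ).const_mul 16).const_sub 1)).congr_deriv ?_
        ring
      refine ((hDd.fun_pow i).fun_inv (pow_ne_zero _ (mul_ne_zero h1 h2))).congr_deriv ?_
      rcases i with _ | i
      · simp
      · rw [Nat.add_sub_cancel]
        have hw := mul_ne_zero h1 h2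
        generalize τ * (1 - 16 * τ) = w at hw
        field_simp
        ring
    · obtain ⟨h1, h2⟩ := hne τ hτ
      refine Eq.congr_left ?_
      simp only [eval_add, eval_sub, eval_mul, eval_pow, eval_C, eval_X, eval_one, eval_ofNat,
        eval_neg, hD, pow_succ]
      have hw := pow_ne_zero i (mul_ne_zero h1 h2)
      generalize (τ * (1 - 16 * τ)) ^ i = u at hw ⊢
      obtain ⟨v, hv⟩ : ∃ v, v = 1 - 16 * τ := ⟨_, rfl⟩
      rw [← hv] at h2 ⊢
      field_simp
      rw [hv]
      ring

/-- The number of zeros of `α m + β a + γ f` for polynomials of degree at most `d`. -/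
lemma zerosLE (h : PicardFuchs m a f) {d : ℕ} {α β γ : ℝ[X]} (hα : α.natDegree ≤ d)
    (hβ : β.natDegree ≤ d) (hγ : γ.natDegree ≤ d) :
    ZerosLE (Ioo 0 (1 / 16)) (fun τ => α.eval τ * m τ + (β.eval τ * a τ + γ.eval τ * f τ))
      (7 * d + 7) := by
  refine ((h.zerosLE_of_degree_lt (d + 1) 0 d α β γ ?_ hβ hγ (by omega)).congr ?_).mono (by omega)
  · exact degree_le_natDegree.trans_lt (Nat.cast_lt.mpr (Nat.lt_succ_of_le hα))
  · simp

end PicardFuchs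

/-- Half the weighted width of the oval over the abscissa `x`. -/
noncomputable def ovalWidth (τ x : ℝ) : ℝ := √((x * (1 - x)) ^ 2 - τ)

/-- The moments `∫ x^b w dx` of the width of the oval. -/
noncomputable def ovalMoment (b : ℤ) (τ : ℝ) : ℝ := ∫ x in (0 : ℝ)..1, x ^ b * ovalWidth τ x

lemma hasDerivAt_mul_sqrt (u : ℝ) : HasDerivAt (fun u : ℝ => u * √u) (3 / 2 * √u) u := by
  rcases eq_or_ne u 0 with rfl | hu
  · rw [hasDerivAt_iff_tendsto_slope]
    have h : Tendsto (fun u : ℝ => √u) (nhdsWithin 0 {0}ᶜ) (nhds (3 / 2 * √0)) := by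
      have := Real.continuous_sqrt.tendsto 0
      simp only [Real.sqrt_zero, mul_zero] at this ⊢
      exact this.mono_left nhdsWithin_le_nhds
    refine h.congr' ?_
    filter_upwards [self_mem_nhdsWithin] with x hx
    have : x ≠ 0 := hx
    simp [slope_def_field, this]
  · refine ((hasDerivAt_id' u).fun_mul (Real.hasDerivAt_sqrt hu)).congr_deriv ?_
    rcases lt_or_gt_of_ne hu with h | h
    · simp [Real.sqrt_eq_zero_of_nonpos h.le]
    · have := Real.sqrt_pos.mpr h
      field_simp
      rw [Real.sq_sqrt h.le]
      ring

lemma continuous_zpow_mul {g : ℝ → ℝ} (hg : Continuous g) (h0 : ∀ᶠ x in nhds 0, g x = 0)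
    (b : ℤ) : Continuous fun x => x ^ b * g x := by
  refine continuous_iff_continuousAt.mpr fun x => ?_
  rcases eq_or_ne x 0 with rfl | hx
  · refine (continuousAt_const (y := (0 : ℝ))).congr ?_
    filter_upwards [h0] with x hx
    simp [hx]
  · exact (continuousAt_zpow₀ x b (Or.inl hx)).mul hg.continuousAt

lemma eventually_sq_sub_neg {τ : ℝ} (hτ : 0 < τ) :
    ∀ᶠ x : ℝ in nhds 0, (x * (1 - x)) ^ 2 - τ < 0 :=
  (by fun_prop : Continuous fun x : ℝ => (x * (1 - x)) ^ 2 - τ).continuousAt.eventually_lt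
    continuousAt_const (by simpa using hτ)

lemma eventually_ovalWidth_eq_zero {τ : ℝ} (hτ : 0 < τ) :
    ∀ᶠ x in nhds 0, ovalWidth τ x = 0 := by
  filter_upwards [eventually_sq_sub_neg hτ] with x hx
  exact Real.sqrt_eq_zero_of_nonpos hx.le

lemma ovalWidth_zero_right {τ : ℝ} (hτ : 0 < τ) : ovalWidth τ 0 = 0 :=
  (eventually_ovalWidth_eq_zero hτ).self_of_nhds

lemma continuous_ovalWidth (τ : ℝ) : Continuous (ovalWidth τ) := by
  unfold ovalWidth
  fun_prop

lemma continuous_zpow_mul_ovalWidth {τ : ℝ} (hτ : 0 < τ) (b : ℤ) :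
    Continuous fun x => x ^ b * ovalWidth τ x :=
  continuous_zpow_mul (continuous_ovalWidth τ) (eventually_ovalWidth_eq_zero hτ) b

lemma intervalIntegrable_zpow_mul_ovalWidth {τ : ℝ} (hτ : 0 < τ) (b : ℤ) :
    IntervalIntegrable (fun x => x ^ b * ovalWidth τ x) volume 0 1 :=
  (continuous_zpow_mul_ovalWidth hτ b).intervalIntegrable 0 1

/-- The relation between moments obtained by integrating `d(x^c w^3)`. -/
lemma ovalMoment_relation {τ : ℝ} (hτ : 0 < τ) (c : ℤ) :
    (c + 3) * ovalMoment (c + 1) τ - (2 * c + 9) * ovalMoment (c + 2) τ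
      + (c + 6) * ovalMoment (c + 3) τ - c * τ * ovalMoment (c - 1) τ = 0 := by
  have hI := intervalIntegrable_zpow_mul_ovalWidth hτ
  have hder : ∀ x : ℝ, HasDerivAt
      (fun x => x ^ c * (((x * (1 - x)) ^ 2 - τ) * √((x * (1 - x)) ^ 2 - τ)))
      ((c + 3) * (x ^ (c + 1) * ovalWidth τ x) - (2 * c + 9) * (x ^ (c + 2) * ovalWidth τ x)
        + (c + 6) * (x ^ (c + 3) * ovalWidth τ x)
        - c * τ * (x ^ (c - 1) * ovalWidth τ x)) x := by
    intro x
    rcases eq_or_ne x 0 with rfl | hx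
    · simp only [ovalWidth_zero_right hτ, mul_zero, sub_zero, add_zero]
      refine (hasDerivAt_const 0 (0 : ℝ)).congr_of_eventuallyEq ?_
      filter_upwards [eventually_sq_sub_neg hτ] with x hx
      simp [Real.sqrt_eq_zero_of_nonpos hx.le]
    · have hinner : HasDerivAt (fun x : ℝ => (x * (1 - x)) ^ 2 - τ)
          (2 * (x * (1 - x)) * (1 - 2 * x)) x := by
        refine ((((hasDerivAt_id' x).fun_mul ((hasDerivAt_id' x).const_sub 1)).fun_pow
          2).sub_const τ).congr_deriv ?_
        ring
      refine ((hasDerivAt_zpow c x (Or.inl hx)).fun_mul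
        ((hasDerivAt_mul_sqrt _).comp x hinner)).congr_deriv ?_
      simp only [ovalWidth, zpow_add₀ hx, zpow_sub₀ hx, zpow_ofNat, Function.comp_apply]
      field_simp
      ring
  have hftc := intervalIntegral.integral_eq_sub_of_hasDerivAt (a := 0) (b := 1)
    (fun x _ => hder x) (by
      refine Continuous.intervalIntegrable ?_ 0 1
      have := continuous_zpow_mul_ovalWidth hτ
      fun_prop)
  have hc := fun (r : ℝ) (b : ℤ) => (hI b).const_mul r
  rw [intervalIntegral.integral_sub (((hc _ _).sub (hc _ _)).add (hc _ _)) (hc _ _),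
    intervalIntegral.integral_add ((hc _ _).sub (hc _ _)) (hc _ _),
    intervalIntegral.integral_sub (hc _ _) (hc _ _)] at hftc
  simp only [intervalIntegral.integral_const_mul] at hftc
  simpa [ovalMoment, Real.sqrt_eq_zero_of_nonpos (neg_nonpos.mpr hτ.le)] using hftc

lemma ovalMoment_one {τ : ℝ} (hτ : 0 < τ) : ovalMoment 1 τ = ovalMoment 0 τ / 2 := by
  have hI := intervalIntegrable_zpow_mul_ovalWidth hτ
  have h := intervalIntegral.integral_comp_sub_left (a := 0) (b := 1)
    (fun x => x ^ (1 : ℤ) * ovalWidth τ x) 1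
  have h2 : ∀ x : ℝ, (1 - x) ^ (1 : ℤ) * ovalWidth τ (1 - x)
      = x ^ (0 : ℤ) * ovalWidth τ x - x ^ (1 : ℤ) * ovalWidth τ x := fun x => by
    have : ovalWidth τ (1 - x) = ovalWidth τ x := by
      unfold ovalWidth
      congr 2
      ring
    rw [this]
    simp only [zpow_one, zpow_zero]
    ring
  simp only [h2, sub_self, sub_zero] at h
  rw [intervalIntegral.integral_sub (hI 0) (hI 1)] at h
  unfold ovalMoment
  linarith

lemma ovalWidth_le {τ x : ℝ} (hτ : 0 ≤ τ) (hx : x ∈ Icc (0 : ℝ) 1) :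
    ovalWidth τ x ≤ x * (1 - x) :=
  Real.sqrt_le_iff.mpr ⟨mul_nonneg hx.1 (sub_nonneg.mpr hx.2), by linarith⟩

/-- The derivative with respect to the level of the integrals of `x^b w^3`. -/
lemma hasDerivAt_ovalMoment {τ : ℝ} (hτ : 0 < τ) {b : ℤ} (hb : -1 ≤ b) :
    HasDerivAt (fun τ => ovalMoment (b + 2) τ - 2 * ovalMoment (b + 3) τ
      + ovalMoment (b + 4) τ - τ * ovalMoment b τ) (-(3 / 2) * ovalMoment b τ) τ := by
  have hcont : ∀ τ : ℝ, 0 < τ → Continuous fun x : ℝ =>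
      x ^ b * (((x * (1 - x)) ^ 2 - τ) * √((x * (1 - x)) ^ 2 - τ)) := fun τ hτ => by
    refine continuous_zpow_mul (by fun_prop) ?_ b
    filter_upwards [eventually_sq_sub_neg hτ] with x hx
    simp [Real.sqrt_eq_zero_of_nonpos hx.le]
  have key := (intervalIntegral.hasDerivAt_integral_of_dominated_loc_of_deriv_le
    (μ := volume) (a := 0) (b := 1) (x₀ := τ) (bound := fun _ => 3 / 2)
    (F := fun τ x => x ^ b * (((x * (1 - x)) ^ 2 - τ) * √((x * (1 - x)) ^ 2 - τ)))
    (F' := fun τ x => -(3 / 2) * (x ^ b * ovalWidth τ x)) (Ioi_mem_nhds hτ)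
    (by
      filter_upwards [Ioi_mem_nhds hτ] with σ hσ
      exact (hcont σ hσ).aestronglyMeasurable)
    ((hcont τ hτ).intervalIntegrable 0 1)
    ((continuous_zpow_mul_ovalWidth hτ b).const_mul _).aestronglyMeasurable
    (Eventually.of_forall fun x hx σ hσ => ?_) intervalIntegrable_const
    (Eventually.of_forall fun x _ σ _ => ?_)).2
  · rw [intervalIntegral.integral_const_mul] at key
    refine key.congr_of_eventuallyEq ?_
    filter_upwards [Ioi_mem_nhds hτ] with σ hσ
    have hI := intervalIntegrable_zpow_mul_ovalWidth hσ
    unfold ovalMoment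
    rw [← intervalIntegral.integral_const_mul, ← intervalIntegral.integral_const_mul,
      ← intervalIntegral.integral_sub (hI _) ((hI _).const_mul _),
      ← intervalIntegral.integral_add ((hI _).sub ((hI _).const_mul _)) (hI _),
      ← intervalIntegral.integral_sub (((hI _).sub ((hI _).const_mul _)).add (hI _))
        ((hI _).const_mul _)]
    refine intervalIntegral.integral_congr fun x _ => ?_
    rcases eq_or_ne x 0 with rfl | hx
    · simp [ovalWidth_zero_right hσ, Real.sqrt_eq_zero_of_nonpos (neg_nonpos.mpr (le_of_lt hσ))]
    · simp only [ovalWidth, zpow_add₀ hx, zpow_ofNat]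
      ring
  · rw [uIoc_of_le zero_le_one] at hx
    have h1 : x ^ b ≤ x⁻¹ := by
      rw [← zpow_neg_one]
      exact zpow_le_zpow_right_of_le_one₀ hx.1 hx.2 hb
    have h2 := ovalWidth_le (le_of_lt hσ) ⟨hx.1.le, hx.2⟩
    have h3 : x ^ b * ovalWidth σ x ≤ x⁻¹ * (x * (1 - x)) :=
      mul_le_mul h1 h2 (Real.sqrt_nonneg _) (inv_nonneg.mpr hx.1.le)
    rw [inv_mul_cancel_left₀ hx.1.ne'] at h3
    have h4 : 0 ≤ x ^ b * ovalWidth σ x := mul_nonneg (zpow_nonneg hx.1.le b) (Real.sqrt_nonneg _)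
    rw [norm_mul, Real.norm_of_nonneg h4]
    norm_num
    linarith [hx.1]
  · refine (((hasDerivAt_mul_sqrt _).comp σ ((hasDerivAt_id' σ).const_sub
      ((x * (1 - x)) ^ 2))).const_mul (x ^ b)).congr_deriv ?_
    simp only [ovalWidth]
    ring

lemma ovalMoment_zero_pos {τ : ℝ} (hτ : τ ∈ Ioo (0 : ℝ) (1 / 16)) : 0 < ovalMoment 0 τ := by
  refine intervalIntegral.integral_pos zero_lt_one
    (continuous_zpow_mul_ovalWidth hτ.1 0).continuousOn (fun x _ => ?_) ⟨1 / 2, by norm_num, ?_⟩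
  · simp [ovalWidth]
  · rw [zpow_zero, one_mul]
    exact Real.sqrt_pos.mpr (by linarith [hτ.2])

lemma picardFuchs_ovalMoment : PicardFuchs (ovalMoment (-1)) (ovalMoment 0)
    (fun τ => ovalMoment 1 τ - ovalMoment 2 τ) := by
  have hW : ∀ τ : ℝ, 0 < τ →
      ovalMoment 3 τ = (3 * ovalMoment 2 τ - ovalMoment 1 τ) / 2 ∧
      7 * ovalMoment 4 τ = 11 * ovalMoment 3 τ - 4 * ovalMoment 2 τ + τ * ovalMoment 0 τ ∧
      8 * ovalMoment 5 τ = 13 * ovalMoment 4 τ - 5 * ovalMoment 3 τ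
        + 2 * τ * ovalMoment 1 τ := fun τ hτ => by
    have h0 := ovalMoment_relation hτ 0
    have h1 := ovalMoment_relation hτ 1
    have h2 := ovalMoment_relation hτ 2
    norm_num at h0 h1 h2
    refine ⟨?_, ?_, ?_⟩ <;> linarith
  have hV0 : ∀ τ : ℝ, 0 < τ → HasDerivAt (fun τ => (3 * (ovalMoment 1 τ - ovalMoment 2 τ)
      - 12 * τ * ovalMoment 0 τ) / 14) (-(3 / 2) * ovalMoment 0 τ) τ := fun τ hτ => by
    refine (hasDerivAt_ovalMoment hτ (b := 0) (by norm_num)).congr_of_eventuallyEq ?_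
    filter_upwards [Ioi_mem_nhds hτ] with σ hσ
    obtain ⟨h1, h2, -⟩ := hW σ hσ
    have h3 := ovalMoment_one hσ
    norm_num
    linarith
  have hV1 : ∀ τ : ℝ, 0 < τ → HasDerivAt (fun τ => ((2 - 28 * τ) *
      (ovalMoment 1 τ - ovalMoment 2 τ) - τ * ovalMoment 0 τ) / 42)
      (-(3 / 2) * (ovalMoment 1 τ - ovalMoment 2 τ)) τ := fun τ hτ => by
    have := (hasDerivAt_ovalMoment hτ (b := 1) (by norm_num)).fun_sub
      (hasDerivAt_ovalMoment hτ (b := 2) (by norm_num))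
    rw [← mul_sub] at this
    refine this.congr_of_eventuallyEq ?_
    filter_upwards [Ioi_mem_nhds hτ] with σ hσ
    obtain ⟨h1, h2, h4⟩ := hW σ hσ
    have h3 := ovalMoment_one hσ
    have h5 := ovalMoment_relation hσ 3
    have h6 : σ * ovalMoment 1 σ = σ * ovalMoment 0 σ / 2 := by rw [h3]; ring
    norm_num at h5 ⊢
    linarith
  have hW' : ∀ τ : ℝ, 0 < τ → HasDerivAt (fun τ => (ovalMoment 1 τ - ovalMoment 2 τ) / 2
      - τ * ovalMoment (-1) τ) (-(3 / 2) * ovalMoment (-1) τ) τ := fun τ hτ => by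
    refine (hasDerivAt_ovalMoment hτ (b := -1) le_rfl).congr_of_eventuallyEq ?_
    filter_upwards [Ioi_mem_nhds hτ] with σ hσ
    have h1 := (hW σ hσ).1
    norm_num
    linarith
  have hJ : ∀ τ ∈ Ioo (0 : ℝ) (1 / 16), ∀ᶠ σ in nhds τ, σ ≠ 0 ∧ 1 - 16 * σ ≠ 0 := fun τ hτ => by
    filter_upwards [Ioo_mem_nhds hτ.1 hτ.2] with σ hσ
    exact ⟨hσ.1.ne', by linarith [hσ.2]⟩
  have hf : ∀ τ ∈ Ioo (0 : ℝ) (1 / 16), HasDerivAt (fun τ => ovalMoment 1 τ - ovalMoment 2 τ)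
      ((ovalMoment 0 τ - 20 * (ovalMoment 1 τ - ovalMoment 2 τ)) / (1 - 16 * τ)) τ := by
    intro τ hτ
    have hne := (hJ τ hτ).self_of_nhds.2
    have hD : HasDerivAt (fun τ : ℝ => 1 - 16 * τ) (-16) τ := by
      simpa using ((hasDerivAt_id' τ).const_mul 16).const_sub 1
    refine (((((hV1 τ hτ.1).const_mul 24).fun_sub
      ((hV0 τ hτ.1).const_mul (2 / 3))).fun_div hD hne).congr_of_eventuallyEq ?_).congr_deriv ?_
    · filter_upwards [hJ τ hτ] with σ hσ
      rw [eq_div_iff hσ.2]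
      ring
    · field_simp
      ring
  refine ⟨fun τ => ovalMoment_zero_pos, fun τ hτ => ?_, hf, fun τ hτ => ?_⟩
  · have hne := (hJ τ hτ).self_of_nhds
    refine (((((hf τ hτ).const_mul 3).fun_sub ((hV0 τ hτ.1).const_mul 14)).fun_div
      ((hasDerivAt_id' τ).const_mul 12) (by simpa using hne.1)).congr_of_eventuallyEq
      ?_).congr_deriv ?_
    · filter_upwards [hJ τ hτ] with σ hσ
      rw [eq_div_iff (by simpa using hσ.1)]
      ring
    · obtain ⟨h1, h2⟩ := hne
      obtain ⟨v, hv⟩ : ∃ v, v = 1 - 16 * τ := ⟨_, rfl⟩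
      rw [← hv] at h2 ⊢
      field_simp
      rw [hv]
      ring
  · have hne := (hJ τ hτ).self_of_nhds
    refine (((((hf τ hτ).const_mul (1 / 2)).fun_sub (hW' τ hτ.1)).fun_div
      (hasDerivAt_id' τ) hne.1).congr_of_eventuallyEq ?_).congr_deriv ?_
    · filter_upwards [hJ τ hτ] with σ hσ
      rw [eq_div_iff hσ.1]
      ring
    · obtain ⟨h1, h2⟩ := hne
      obtain ⟨v, hv⟩ : ∃ v, v = 1 - 16 * τ := ⟨_, rfl⟩
      rw [← hv] at h2 ⊢
      field_simp
      ring

open Polynomial in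
/-- `F` is a combination of the three basic integrals with coefficients polynomials in `τ` of
degree at most `k / 4`. -/
def IsMomentCombination (k : ℕ) (F : ℝ → ℝ) : Prop :=
  ∃ α β γ : ℝ[X], 4 * α.natDegree ≤ k ∧ 4 * β.natDegree ≤ k ∧ 4 * γ.natDegree ≤ k ∧
    ∀ τ : ℝ, 0 < τ → F τ = α.eval τ * ovalMoment (-1) τ
      + (β.eval τ * ovalMoment 0 τ + γ.eval τ * (ovalMoment 1 τ - ovalMoment 2 τ))

namespace IsMomentCombination

open Polynomial

variable {k l : ℕ} {F G : ℝ → ℝ}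

lemma congr (h : IsMomentCombination k F) (hFG : ∀ τ : ℝ, 0 < τ → G τ = F τ) :
    IsMomentCombination k G := by
  obtain ⟨α, β, γ, hα, hβ, hγ, h⟩ := h
  exact ⟨α, β, γ, hα, hβ, hγ, fun τ hτ => (hFG τ hτ).trans (h τ hτ)⟩

lemma mono (h : IsMomentCombination k F) (hkl : k ≤ l) : IsMomentCombination l F := by
  obtain ⟨α, β, γ, hα, hβ, hγ, h⟩ := h
  exact ⟨α, β, γ, hα.trans hkl, hβ.trans hkl, hγ.trans hkl, h⟩

lemma zero : IsMomentCombination k fun _ => 0 := ⟨0, 0, 0, by simp⟩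

lemma add (hF : IsMomentCombination k F) (hG : IsMomentCombination k G) :
    IsMomentCombination k fun τ => F τ + G τ := by
  obtain ⟨α, β, γ, hα, hβ, hγ, hF⟩ := hF
  obtain ⟨α', β', γ', hα', hβ', hγ', hG⟩ := hG
  have hdeg : ∀ {p q : ℝ[X]}, 4 * p.natDegree ≤ k → 4 * q.natDegree ≤ k →
      4 * (p + q).natDegree ≤ k := fun {p q} hp hq => by
    have := natDegree_add_le p q
    omega
  refine ⟨α + α', β + β', γ + γ', hdeg hα hα', hdeg hβ hβ', hdeg hγ hγ', fun τ hτ => ?_⟩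
  simp only [hF τ hτ, hG τ hτ, eval_add]
  ring

lemma const_mul (hF : IsMomentCombination k F) (c : ℝ) :
    IsMomentCombination k fun τ => c * F τ := by
  obtain ⟨α, β, γ, hα, hβ, hγ, hF⟩ := hF
  have hdeg : ∀ {p : ℝ[X]}, 4 * p.natDegree ≤ k → 4 * (C c * p).natDegree ≤ k :=
    fun {p} hp => by
      have := natDegree_C_mul_le c p
      omega
  refine ⟨C c * α, C c * β, C c * γ, hdeg hα, hdeg hβ, hdeg hγ, fun τ hτ => ?_⟩
  simp only [hF τ hτ, eval_mul, eval_C]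
  ring

lemma mul_level (hF : IsMomentCombination k F) :
    IsMomentCombination (k + 4) fun τ => τ * F τ := by
  obtain ⟨α, β, γ, hα, hβ, hγ, hF⟩ := hF
  have hdeg : ∀ {p : ℝ[X]}, 4 * p.natDegree ≤ k → 4 * (X * p).natDegree ≤ k + 4 :=
    fun {p} hp => by
      have := natDegree_mul_le_of_le natDegree_X_le (le_refl p.natDegree)
      omega
  refine ⟨X * α, X * β, X * γ, hdeg hα, hdeg hβ, hdeg hγ, fun τ hτ => ?_⟩
  simp only [hF τ hτ, eval_mul, eval_X]
  ring

lemma sum {ι : Type*} {s : Finset ι} {F : ι → ℝ → ℝ}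
    (h : ∀ i ∈ s, IsMomentCombination k (F i)) :
    IsMomentCombination k fun τ => ∑ i ∈ s, F i τ := by
  classical
  induction s using Finset.induction_on with
  | empty => simpa using zero
  | insert i s hi ih =>
    simp only [Finset.sum_insert hi]
    exact (h i (by simp)).add (ih fun j hj => h j (by simp [hj]))

lemma ovalMoment_natCast_sub_one (n : ℕ) : IsMomentCombination n (ovalMoment (n - 1)) := by
  induction n using Nat.strong_induction_on with
  | _ n ih =>
  have h1 : IsMomentCombination 0 (ovalMoment 1) :=
    ⟨0, C (1 / 2), 0, by simp, by simp, by simp, fun τ hτ => by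
      simp [ovalMoment_one hτ]; ring⟩
  have h2 : IsMomentCombination 0 (ovalMoment 2) :=
    ⟨0, C (1 / 2), C (-1), by simp, by simp, by simp, fun τ hτ => by
      simp [ovalMoment_one hτ]; ring⟩
  match n, ih with
  | 0, _ => exact ⟨1, 0, 0, by simp⟩
  | 1, _ => exact ⟨0, 1, 0, by simp⟩
  | 2, _ => exact (h1.mono (Nat.zero_le 2)).congr fun τ _ => by norm_num
  | 3, _ => exact (h2.mono (Nat.zero_le 3)).congr fun τ _ => by norm_num
  | 4, _ =>
    refine (((h2.const_mul (3 / 2)).add (h1.const_mul (-1 / 2))).mono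
      (Nat.zero_le 4)).congr fun τ hτ => ?_
    have h0 := ovalMoment_relation hτ 0
    norm_num at h0 ⊢
    linarith
  | n + 5, ih =>
    have e1 := (ih (n + 4) (by omega)).mono (show n + 4 ≤ n + 5 by omega)
    have e2 := (ih (n + 3) (by omega)).mono (show n + 3 ≤ n + 5 by omega)
    have e3 := (ih (n + 1) (by omega)).mul_level
    refine (((e1.const_mul ((2 * n + 11) / (n + 7))).add (e2.const_mul (-(n + 4) / (n + 7)))).add
      (e3.const_mul ((n + 1) / (n + 7)))).congr fun τ hτ => ?_
    have h := ovalMoment_relation hτ (n + 1)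
    have hn : (n : ℝ) + 7 ≠ 0 := by positivity
    push_cast at h ⊢
    ring_nf at h ⊢
    field_simp
    ring_nf
    linarith

lemma pow_mul {i : ℕ} (hF : IsMomentCombination k F) :
    IsMomentCombination (k + 4 * i) fun τ => τ ^ i * F τ := by
  induction i with
  | zero => simpa using hF
  | succ i ih => exact (ih.mul_level.mono (by omega)).congr fun τ _ => by ring

lemma pow_mul_ovalMoment (i : ℕ) : ∀ (b : ℤ), -1 - 2 * (i : ℤ) ≤ b → 4 * (i : ℤ) + b + 1 ≤ k →
    IsMomentCombination k fun τ => τ ^ i * ovalMoment b τ := by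
  have hpos : ∀ (i : ℕ) (b : ℤ), -1 ≤ b → 4 * (i : ℤ) + b + 1 ≤ k →
      IsMomentCombination k fun τ => τ ^ i * ovalMoment b τ := fun i b hb hk => by
    obtain ⟨n, hn⟩ := Int.eq_ofNat_of_zero_le (show 0 ≤ b + 1 by omega)
    obtain rfl : b = n - 1 := by omega
    exact (ovalMoment_natCast_sub_one n).pow_mul.mono (by omega)
  induction i with
  | zero => exact fun b hb hk => hpos 0 b (by simpa using hb) hk
  | succ i ih =>
    intro b hb hk
    by_cases hb1 : -1 ≤ b
    · exact hpos _ b hb1 hk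
    push_cast at hb hk
    have e1 := ih (b + 2) (by omega) (by omega)
    have e2 := ih (b + 3) (by omega) (by omega)
    have e3 := ih (b + 4) (by omega) (by omega)
    refine (((e1.const_mul ((b + 4) / (b + 1))).add (e2.const_mul (-(2 * b + 11) / (b + 1)))).add
      (e3.const_mul ((b + 7) / (b + 1)))).congr fun τ hτ => ?_
    have h := ovalMoment_relation hτ (b + 1)
    have hb0 : (b : ℝ) + 1 ≠ 0 := by
      have : b + 1 ≠ 0 := by omega
      exact_mod_cast this
    simp only [add_assoc, add_sub_cancel_right, Int.cast_add, Int.cast_one] at h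
    norm_num at h
    field_simp
    rw [pow_succ]
    linear_combination (-τ ^ i) * h

end IsMomentCombination

/-- `g` is a density whose integral against the width of the oval is a combination of the basic
integrals. -/
def IsMomentDensity (k : ℕ) (g : ℝ → ℝ → ℝ) : Prop :=
  (∀ τ : ℝ, 0 < τ → IntervalIntegrable (fun x => g τ x * ovalWidth τ x) volume 0 1) ∧
    IsMomentCombination k fun τ => ∫ x in (0 : ℝ)..1, g τ x * ovalWidth τ x

namespace IsMomentDensity

variable {k : ℕ} {g h : ℝ → ℝ → ℝ}

lemma congr (hg : IsMomentDensity k g) (hgh : ∀ τ x, x ∈ Ioc (0 : ℝ) 1 → g τ x = h τ x) :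
    IsMomentDensity k h := by
  have key : ∀ τ, EqOn (fun x => g τ x * ovalWidth τ x) (fun x => h τ x * ovalWidth τ x)
      (uIoc 0 1) := fun τ x hx => by
    rw [uIoc_of_le zero_le_one] at hx
    simp only [hgh τ x hx]
  refine ⟨fun τ hτ => IntervalIntegrable.congr (key τ) (hg.1 τ hτ), hg.2.congr fun τ _ => ?_⟩
  exact (intervalIntegral.integral_congr_ae (Eventually.of_forall (key τ))).symm

lemma add (hg : IsMomentDensity k g) (hh : IsMomentDensity k h) :
    IsMomentDensity k fun τ x => g τ x + h τ x := by
  simp only [IsMomentDensity, add_mul]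
  refine ⟨fun τ hτ => (hg.1 τ hτ).add (hh.1 τ hτ), (hg.2.add hh.2).congr fun τ hτ => ?_⟩
  exact intervalIntegral.integral_add (hg.1 τ hτ) (hh.1 τ hτ)

lemma const_mul (hg : IsMomentDensity k g) (c : ℝ) :
    IsMomentDensity k fun τ x => c * g τ x := by
  simp only [IsMomentDensity, mul_assoc]
  refine ⟨fun τ hτ => (hg.1 τ hτ).const_mul c, (hg.2.const_mul c).congr fun τ hτ => ?_⟩
  exact intervalIntegral.integral_const_mul _ _

lemma pow_mul_zpow {i : ℕ} {b : ℤ} (hb : -1 - 2 * (i : ℤ) ≤ b) (hk : 4 * (i : ℤ) + b + 1 ≤ k) :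
    IsMomentDensity k fun τ x => τ ^ i * x ^ b := by
  simp only [IsMomentDensity, mul_assoc]
  refine ⟨fun τ hτ => (intervalIntegrable_zpow_mul_ovalWidth hτ b).const_mul _,
    (IsMomentCombination.pow_mul_ovalMoment i b hb hk).congr fun τ hτ => ?_⟩
  exact intervalIntegral.integral_const_mul _ _

end IsMomentDensity

/-- The complete homogeneous polynomials in the two ends of the vertical section of the oval over
the abscissa `x`, whose sum is `1 - x` and whose product is `τ / (4 x^2)`. -/
noncomputable def sectionSum (τ x : ℝ) : ℕ → ℝ
  | 0 => 1
  | 1 => 1 - x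
  | j + 2 => (1 - x) * sectionSum τ x (j + 1) - τ / 4 * x ^ (-2 : ℤ) * sectionSum τ x j

lemma isMomentDensity_sectionSum {k : ℕ} (j : ℕ) : ∀ (i : ℕ) (b : ℤ), -1 - 2 * (i : ℤ) ≤ b →
    4 * (i : ℤ) + b + 1 + j ≤ k →
    IsMomentDensity k fun τ x => τ ^ i * x ^ b * sectionSum τ x j := by
  induction j using Nat.strong_induction_on with
  | _ j ih =>
  intro i b hb hk
  match j, ih with
  | 0, _ =>
    refine (IsMomentDensity.pow_mul_zpow hb (by simpa using hk)).congr fun τ x _ => ?_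
    simp [sectionSum]
  | 1, _ =>
    push_cast at hk
    refine ((IsMomentDensity.pow_mul_zpow hb (by omega)).add
      ((IsMomentDensity.pow_mul_zpow (i := i) (b := b + 1) (by omega) (by omega)).const_mul
        (-1))).congr fun τ x hx => ?_
    rw [sectionSum, zpow_add_one₀ hx.1.ne']
    ring
  | j + 2, ih =>
    push_cast at hk
    refine (((ih (j + 1) (by omega) i b hb (by push_cast; omega)).add
      ((ih (j + 1) (by omega) i (b + 1) (by omega) (by push_cast; omega)).const_mul (-1))).add
      ((ih j (by omega) (i + 1) (b - 2) (by push_cast; omega) (by push_cast; omega)).const_mul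
        (-1 / 4))).congr fun τ x hx => ?_
    rw [sectionSum, zpow_add_one₀ hx.1.ne', sub_eq_add_neg b, zpow_add₀ hx.1.ne']
    ring

/-- The lower end of the vertical section of the oval over the abscissa `x`. -/
noncomputable def sectionLower (τ x : ℝ) : ℝ := (1 - x - ovalWidth τ x / x) / 2

/-- The upper end of the vertical section of the oval over the abscissa `x`. -/
noncomputable def sectionUpper (τ x : ℝ) : ℝ := (1 - x + ovalWidth τ x / x) / 2

lemma sectionLower_le_sectionUpper {τ x : ℝ} (hx : 0 < x) :
    sectionLower τ x ≤ sectionUpper τ x := by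
  have : 0 ≤ ovalWidth τ x / x := div_nonneg (Real.sqrt_nonneg _) hx.le
  unfold sectionLower sectionUpper
  linarith

lemma sectionLower_mul_sectionUpper {τ x : ℝ} (hx : 0 < x) (hτ : τ ≤ (x * (1 - x)) ^ 2) :
    sectionLower τ x * sectionUpper τ x = τ / 4 * x ^ (-2 : ℤ) := by
  have h : ovalWidth τ x ^ 2 = (x * (1 - x)) ^ 2 - τ := Real.sq_sqrt (sub_nonneg.mpr hτ)
  rw [zpow_neg, zpow_ofNat]
  unfold sectionLower sectionUpper
  field_simp
  linear_combination (-4 : ℝ) * h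

lemma sectionUpper_pow_sub {τ x : ℝ} (hx : 0 < x) (hτ : τ ≤ (x * (1 - x)) ^ 2) (j : ℕ) :
    sectionUpper τ x ^ (j + 1) - sectionLower τ x ^ (j + 1)
      = ovalWidth τ x / x * sectionSum τ x j := by
  have hadd : sectionUpper τ x + sectionLower τ x = 1 - x := by
    unfold sectionLower sectionUpper
    ring
  have hsub : sectionUpper τ x - sectionLower τ x = ovalWidth τ x / x := by
    unfold sectionLower sectionUpper
    ring
  have hmul := sectionLower_mul_sectionUpper hx hτ
  induction j using Nat.strong_induction_on with
  | _ j ih =>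
  match j, ih with
  | 0, _ => simpa [sectionSum] using hsub
  | 1, _ =>
    rw [sectionSum, ← hadd, ← hsub]
    ring
  | j + 2, ih =>
    rw [sectionSum, mul_sub, mul_left_comm, ← ih (j + 1) (by omega), mul_left_comm,
      ← ih j (by omega), ← hadd, ← hmul]
    ring

lemma mem_Δset_iff {t x y : ℝ} (ht : 0 < t) (hx : 0 < x) :
    (x, y) ∈ Δset t ↔ x ≤ 1 ∧ 4 * t ≤ (x * (1 - x)) ^ 2 ∧
      y ∈ Icc (sectionLower (4 * t) x) (sectionUpper (4 * t) x) := by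
  have hle := sectionLower_le_sectionUpper (τ := 4 * t) hx
  have hfac : 4 * t ≤ (x * (1 - x)) ^ 2 → x ^ 2 * y * (1 - x - y) - t
      = x ^ 2 * ((y - sectionLower (4 * t) x) * (sectionUpper (4 * t) x - y)) := fun h => by
    have hadd : sectionUpper (4 * t) x + sectionLower (4 * t) x = 1 - x := by
      unfold sectionLower sectionUpper
      ring
    have hmul := sectionLower_mul_sectionUpper hx h
    rw [zpow_neg, zpow_ofNat] at hmul
    have hmul' : x ^ 2 * (sectionLower (4 * t) x * sectionUpper (4 * t) x) = t := by
      rw [hmul]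
      field_simp
    linear_combination hmul' - x ^ 2 * y * hadd
  constructor
  · rintro ⟨-, hy, h⟩
    simp only at hy h
    have hxy : 0 < 1 - x - y := by
      by_contra! hn
      nlinarith [mul_nonneg (mul_nonneg (sq_nonneg x) hy.le) (neg_nonneg.mpr hn)]
    have h4 : 4 * t ≤ (x * (1 - x)) ^ 2 := by
      nlinarith [sq_nonneg (x * (1 - x - 2 * y))]
    refine ⟨by linarith, h4, ?_⟩
    have h0 : 0 ≤ (y - sectionLower (4 * t) x) * (sectionUpper (4 * t) x - y) := by
      refine nonneg_of_mul_nonneg_right ?_ (sq_pos_of_pos hx)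
      rw [← hfac h4]
      linarith
    rcases mul_nonneg_iff.mp h0 with h | h
    · exact ⟨by linarith, by linarith⟩
    · exact ⟨by linarith, by linarith⟩
  · rintro ⟨hx1, h4, hy⟩
    have hmul := sectionLower_mul_sectionUpper hx h4
    have hup : 0 ≤ sectionUpper (4 * t) x := by
      have : 0 ≤ ovalWidth (4 * t) x / x := div_nonneg (Real.sqrt_nonneg _) hx.le
      unfold sectionUpper
      linarith
    have hlow : 0 < sectionLower (4 * t) x := by
      refine pos_of_mul_pos_left ?_ hup
      rw [hmul]
      positivity
    refine ⟨hx, hlow.trans_le hy.1, ?_⟩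
    have h0 := mul_nonneg (sq_nonneg x) (mul_nonneg (sub_nonneg.mpr hy.1) (sub_nonneg.mpr hy.2))
    rw [← hfac h4] at h0
    simp only
    linarith

lemma measurableSet_Δset (t : ℝ) : MeasurableSet (Δset t) :=
  (measurableSet_lt measurable_const measurable_fst).inter
    ((measurableSet_lt measurable_const measurable_snd).inter
      (measurableSet_le measurable_const
        (by fun_prop : Measurable fun z : ℝ × ℝ => z.1 ^ 2 * z.2 * (1 - z.1 - z.2))))

lemma Δset_subset_prod {t : ℝ} (ht : 0 < t) : Δset t ⊆ Icc 0 1 ×ˢ Icc 0 1 := by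
  rintro ⟨x, y⟩ ⟨hx, hy, h⟩
  simp only at hx hy h
  have hxy : 0 < 1 - x - y := by
    by_contra! hn
    nlinarith [mul_nonneg (mul_nonneg (sq_nonneg x) hy.le) (neg_nonneg.mpr hn)]
  exact ⟨⟨hx.le, by linarith⟩, ⟨hy.le, by linarith⟩⟩

lemma integrableOn_Δset {t : ℝ} (ht : 0 < t) {g : ℝ × ℝ → ℝ} (hg : Continuous g) :
    IntegrableOn g (Δset t) :=
  (hg.continuousOn.integrableOn_compact (isCompact_Icc.prod isCompact_Icc)).mono_set
    (Δset_subset_prod ht)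

/-- Integration of a monomial over a vertical section of the oval. -/
lemma integral_section {t : ℝ} (ht : 0 < t) (i j : ℕ) (x : ℝ) :
    ∫ y, (Δset t).indicator (fun z => z.1 ^ i * z.2 ^ j) (x, y)
      = (Ioc (0 : ℝ) 1).indicator (fun x => 1 / ((j : ℝ) + 1) *
          (x ^ ((i : ℤ) - 1) * sectionSum (4 * t) x j) * ovalWidth (4 * t) x) x := by
  by_cases hx : 0 < x ∧ x ≤ 1 ∧ 4 * t ≤ (x * (1 - x)) ^ 2
  · obtain ⟨hx0, hx1, h4⟩ := hx
    have h : ∀ y, (Δset t).indicator (fun z => z.1 ^ i * z.2 ^ j) (x, y)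
        = (Icc (sectionLower (4 * t) x) (sectionUpper (4 * t) x)).indicator
          (fun y => x ^ i * y ^ j) y := fun y => by
      by_cases hy : y ∈ Icc (sectionLower (4 * t) x) (sectionUpper (4 * t) x)
      · rw [indicator_of_mem ((mem_Δset_iff ht hx0).mpr ⟨hx1, h4, hy⟩), indicator_of_mem hy]
      · rw [indicator_of_notMem fun h => hy ((mem_Δset_iff ht hx0).mp h).2.2,
          indicator_of_notMem hy]
    simp only [h]
    rw [integral_indicator measurableSet_Icc, integral_Icc_eq_integral_Ioc,
      ← intervalIntegral.integral_of_le (sectionLower_le_sectionUpper hx0),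
      intervalIntegral.integral_const_mul, integral_pow, sectionUpper_pow_sub hx0 h4,
      indicator_of_mem (mem_Ioc.mpr ⟨hx0, hx1⟩), zpow_sub_one₀ hx0.ne', zpow_natCast]
    ring
  · have h : ∀ y, (Δset t).indicator (fun z => z.1 ^ i * z.2 ^ j) (x, y) = 0 := fun y =>
      indicator_of_notMem (fun hy =>
        hx ⟨hy.1, ((mem_Δset_iff ht hy.1).mp hy).1, ((mem_Δset_iff ht hy.1).mp hy).2.1⟩) _
    simp only [h, integral_zero]
    by_cases hx' : x ∈ Ioc (0 : ℝ) 1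
    · have h0 : ovalWidth (4 * t) x = 0 := by
        refine Real.sqrt_eq_zero_of_nonpos (le_of_lt (sub_neg.mpr ?_))
        by_contra! h4
        exact hx ⟨hx'.1, hx'.2, h4⟩
      rw [indicator_of_mem hx', h0, mul_zero]
    · rw [indicator_of_notMem hx']

/-- Monomials integrated over the region bounded by the oval. -/
lemma integral_Δset_monomial {t : ℝ} (ht : 0 < t) (i j : ℕ) :
    ∫ z in Δset t, z.1 ^ i * z.2 ^ j = ∫ x in (0 : ℝ)..1, 1 / ((j : ℝ) + 1) *
      (x ^ ((i : ℤ) - 1) * sectionSum (4 * t) x j) * ovalWidth (4 * t) x := by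
  have h_integrable : Integrable ((Δset t).indicator fun z : ℝ × ℝ => z.1 ^ i * z.2 ^ j)
      (volume.prod volume) :=
    (integrable_indicator_iff (measurableSet_Δset t)).mpr (integrableOn_Δset ht (by fun_prop))
  rw [← integral_indicator (measurableSet_Δset t), Measure.volume_eq_prod,
    integral_prod _ h_integrable]
  simp only [integral_section ht]
  rw [integral_indicator measurableSet_Ioc, intervalIntegral.integral_of_le zero_le_one]

open MvPolynomial in
lemma isMomentCombination_integral_Δset {n : ℕ} {r : MvPolynomial (Fin 2) ℝ}
    (hr : r.totalDegree ≤ n) :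
    IsMomentCombination n fun τ => ∫ z in Δset (τ / 4), eval ![z.1, z.2] r := by
  have hterm : ∀ d ∈ r.support, IsMomentCombination n fun τ =>
      r.coeff d * ∫ z in Δset (τ / 4), z.1 ^ d 0 * z.2 ^ d 1 := fun d hd => by
    have hdeg : d 0 + d 1 ≤ n := by
      have := (le_totalDegree hd).trans hr
      rwa [Finsupp.sum_fintype _ _ fun _ => rfl, Fin.sum_univ_two] at this
    refine IsMomentCombination.const_mul ?_ _
    refine (((isMomentDensity_sectionSum (d 1) 0 (d 0 - 1) (k := n) (by simp; omega) (by
      push_cast; omega)).const_mul (1 / ((d 1 : ℝ) + 1))).2).congr fun τ hτ => ?_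
    rw [integral_Δset_monomial (by positivity)]
    simp only [mul_div_cancel₀ τ (four_ne_zero' ℝ), pow_zero, one_mul]
  refine (IsMomentCombination.sum hterm).congr fun τ hτ => ?_
  simp only [eval_eq', Fin.prod_univ_two, Matrix.cons_val_zero, Matrix.cons_val_one]
  rw [integral_finsetSum _ fun d _ => (integrableOn_Δset (by positivity) (by fun_prop)).const_mul _]
  simp only [integral_const_mul]

open MvPolynomial in
lemma totalDegree_pderiv_le {σ : Type*} (i : σ) (p : MvPolynomial σ ℝ) :
    (pderiv i p).totalDegree ≤ p.totalDegree := by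
  refine Finset.sup_le fun d hd => ?_
  have h : d + Finsupp.single i 1 ∈ p.support := by
    rw [mem_support_iff, coeff_pderiv] at hd
    exact mem_support_iff.mpr (left_ne_zero_of_mul hd)
  refine le_trans ?_ (le_totalDegree h)
  rw [Finsupp.sum_add_index' (by simp) (by simp)]
  exact Nat.le_add_right _ _

lemma zerosLE_abelInt {n : ℕ} {p q : MvPolynomial (Fin 2) ℝ} (hp : p.totalDegree ≤ n)
    (hq : q.totalDegree ≤ n) :
    ZerosLE (Ioo 0 (1 / 16)) (fun τ => abelInt p q (τ / 4)) (7 * (n / 4) + 7) := by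
  have hr := (MvPolynomial.totalDegree_sub _ _).trans
    (max_le ((totalDegree_pderiv_le (0 : Fin 2) q).trans hq)
      ((totalDegree_pderiv_le (1 : Fin 2) p).trans hp))
  obtain ⟨α, β, γ, hα, hβ, hγ, h⟩ := isMomentCombination_integral_Δset hr
  refine (picardFuchs_ovalMoment.zerosLE (d := n / 4) (α := α) (β := β) (γ := γ)
    (by omega) (by omega) (by omega)).congr fun τ hτ => ?_
  beta_reduce at h ⊢
  rw [abelInt, h τ hτ.1]

/-- the number of isolated zeros of `I(t) = ∮_{δ(t)} (p dx + q dy)` on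
`(0, 1/64)` is finite and at most `(7/4) n + 9`, where `n ≥ deg ω`. -/
theorem number_of_zeros_of_abelian_integral (n : ℕ) (p q : MvPolynomial (Fin 2) ℝ)
    (hp : p.totalDegree ≤ n) (hq : q.totalDegree ≤ n) :
    (({t | t ∈ Set.Ioo (0 : ℝ) (1 / 64) ∧ abelInt p q t = 0 ∧
        ∀ᶠ s in nhdsWithin t (Set.Ioo (0 : ℝ) (1 / 64) \ {t}), abelInt p q s ≠ 0} :
          Set ℝ)).Finite ∧
    4 * ({t | t ∈ Set.Ioo (0 : ℝ) (1 / 64) ∧ abelInt p q t = 0 ∧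
        ∀ᶠ s in nhdsWithin t (Set.Ioo (0 : ℝ) (1 / 64) \ {t}), abelInt p q s ≠ 0} :
          Set ℝ).ncard ≤ 7 * n + 36 := by
  set S : Set ℝ := {t | t ∈ Set.Ioo (0 : ℝ) (1 / 64) ∧ abelInt p q t = 0 ∧
    ∀ᶠ s in nhdsWithin t (Set.Ioo (0 : ℝ) (1 / 64) \ {t}), abelInt p q s ≠ 0}
  rcases zerosLE_abelInt hp hq with h0 | ⟨hfin, hcard⟩
  · have hS : S = ∅ := by
      refine eq_empty_of_forall_notMem ?_
      rintro t ⟨ht, -, hne⟩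
      have hnhds : nhdsWithin t (Ioo (0 : ℝ) (1 / 64) \ {t}) = nhdsWithin t {t}ᶜ :=
        nhdsWithin_inter_of_mem (mem_nhdsWithin_of_mem_nhds (Ioo_mem_nhds ht.1 ht.2))
      have hzero : ∀ᶠ s in nhdsWithin t (Ioo (0 : ℝ) (1 / 64) \ {t}), abelInt p q s = 0 := by
        filter_upwards [self_mem_nhdsWithin] with s hs
        simpa using h0 (4 * s) ⟨by linarith [hs.1.1], by linarith [hs.1.2]⟩
      rw [hnhds] at hne hzero
      obtain ⟨s, h1, h2⟩ := (hne.and hzero).exists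
      exact h1 h2
    simp [hS]
  · have hS : S ⊆ (fun τ => τ / 4) ''
        {τ | τ ∈ Ioo (0 : ℝ) (1 / 16) ∧ abelInt p q (τ / 4) = 0} := by
      rintro t ⟨ht, hzero, -⟩
      have h4 : 4 * t / 4 = t := by ring
      exact ⟨4 * t, ⟨⟨by linarith [ht.1], by linarith [ht.2]⟩, by rwa [h4]⟩, h4⟩
    refine ⟨(hfin.image _).subset hS, ?_⟩
    have := (ncard_le_ncard hS (hfin.image _)).trans ((ncard_image_le hfin).trans hcard)
    omega
end

section
/- For all integers k, l ∈ ℤ and all t ∈ (0, 1/64), the Abelian integrals I_{i,j} satisfy the relation t·(k+1)·I_{k,l}(t) = (k+3)·I_{k+2,l+1}(t) − (k+4)·I_{k+3,l+1}(t) − (k+3)·I_{k+2,l+2}(t). -/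
open MeasureTheory Set Filter

theorem Δset_subset {t : ℝ} (ht : 0 < t) :
    Δset t ⊆ Icc (0 : ℝ) 1 ×ˢ Icc (0 : ℝ) 1 := by
  rintro ⟨x, y⟩ ⟨hx, hy, h⟩
  simp only at hx hy h
  have hpos : 0 < 1 - x - y := by
    by_contra! hneg
    have : x ^ 2 * y * (1 - x - y) ≤ 0 := mul_nonpos_of_nonneg_of_nonpos (by positivity) hneg
    linarith
  exact ⟨⟨hx.le, by linarith⟩, ⟨hy.le, by linarith⟩⟩

theorem isCompact_Δset {t : ℝ} (ht : 0 < t) : IsCompact (Δset t) := by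
  have hclosed : IsClosed (Δset t) := by
    have heq : Δset t =
        {z : ℝ × ℝ | 0 ≤ z.1 ∧ 0 ≤ z.2 ∧ t ≤ z.1 ^ 2 * z.2 * (1 - z.1 - z.2)} := by
      ext ⟨x, y⟩
      constructor
      · rintro ⟨hx, hy, h⟩
        exact ⟨hx.le, hy.le, h⟩
      · rintro ⟨hx, hy, h⟩
        simp only at hx hy h
        refine ⟨lt_of_le_of_ne hx ?_, lt_of_le_of_ne hy ?_, h⟩
        · rintro rfl
          norm_num at h
          linarith
        · rintro rfl
          norm_num at h
          linarith
    rw [heq]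
    exact (isClosed_le continuous_const continuous_fst).and
      ((isClosed_le continuous_const continuous_snd).and
        (isClosed_le continuous_const (by fun_prop)))
  exact (isCompact_Icc.prod isCompact_Icc).of_isClosed_subset hclosed (Δset_subset ht)

theorem integrableOn_zpow_mul_zpow_Δset {t : ℝ} (ht : 0 < t) (i j : ℤ) :
    IntegrableOn (fun z : ℝ × ℝ => z.1 ^ i * z.2 ^ j) (Δset t) := by
  refine ContinuousOn.integrableOn_compact (isCompact_Δset ht) ?_
  exact (continuousOn_fst.zpow₀ i fun z hz => Or.inl hz.1.ne').mul
    (continuousOn_snd.zpow₀ j fun z hz => Or.inl hz.2.1.ne')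

/-- The horizontal slice of `Δset t` at height `y`. -/
def Δslice (t y : ℝ) : Set ℝ :=
  {x : ℝ | (x, y) ∈ Δset t}

theorem isCompact_Δslice {t : ℝ} (ht : 0 < t) (y : ℝ) : IsCompact (Δslice t y) := by
  refine isCompact_Icc.of_isClosed_subset
    ((isCompact_Δset ht).isClosed.preimage (by fun_prop : Continuous fun x : ℝ => (x, y)))
    fun x hx => (Δset_subset ht hx).1

theorem convex_Δslice {t : ℝ} (ht : 0 < t) (y : ℝ) : Convex ℝ (Δslice t y) := by
  rcases le_or_gt y 0 with hy | hy
  · have : Δslice t y = ∅ := eq_empty_of_forall_notMem fun x hx => hy.not_gt hx.2.1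
    rw [this]
    exact convex_empty
  · have hconv : ConvexOn ℝ (Ioi (0 : ℝ)) fun x : ℝ => (t / y) • x ^ (-2 : ℤ) + x :=
      ((convexOn_zpow (-2)).smul (by positivity)).add (convexOn_id (convex_Ioi 0))
    convert hconv.convex_le (1 - y) using 1
    ext x
    simp only [Δslice, Δset, mem_ofPred_eq, mem_Ioi]
    refine and_congr_right fun hx => ?_
    have key : t / y * x ^ (-2 : ℤ) = t / (x ^ 2 * y) := by
      rw [zpow_neg]
      norm_cast
      field_simp
    rw [smul_eq_mul, key, ← le_sub_iff_add_le, div_le_iff₀ (by positivity)]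
    constructor
    · rintro ⟨-, h⟩
      linarith
    · intro h
      exact ⟨hy, by linarith⟩

theorem exists_Δslice_eq_Icc {t : ℝ} (ht : 0 < t) {y : ℝ} (hne : (Δslice t y).Nonempty) :
    ∃ a b : ℝ, a ≤ b ∧ Δslice t y = Icc a b ∧
      a ^ 2 * y * (1 - a - y) = t ∧ b ^ 2 * y * (1 - b - y) = t := by
  have hS : Δslice t y = Icc (sInf (Δslice t y)) (sSup (Δslice t y)) :=
    eq_Icc_of_connected_compact ((convex_Δslice ht y).isConnected hne) (isCompact_Δslice ht y)
  set a := sInf (Δslice t y)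
  set b := sSup (Δslice t y)
  have hab : a ≤ b := nonempty_Icc.mp (hS ▸ hne)
  have ha : a ∈ Δslice t y := hS ▸ left_mem_Icc.mpr hab
  have hb : b ∈ Δslice t y := hS ▸ right_mem_Icc.mpr hab
  have hopen : {x : ℝ | 0 < x ∧ t < x ^ 2 * y * (1 - x - y)} ⊆ Ioo a b := by
    rw [← interior_Icc, ← hS]
    refine interior_maximal (fun x hx => ⟨hx.1, ha.2.1, hx.2.le⟩) ?_
    exact (isOpen_lt continuous_const continuous_id).and
      (isOpen_lt continuous_const (by fun_prop))
  refine ⟨a, b, hab, hS, ?_, ?_⟩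
  · refine le_antisymm (not_lt.mp fun h => ?_) ha.2.2
    exact lt_irrefl a (hopen ⟨ha.1, h⟩).1
  · refine le_antisymm (not_lt.mp fun h => ?_) hb.2.2
    exact lt_irrefl b (hopen ⟨hb.1, h⟩).2

/-- The `x`-derivative of `x ^ (k + 1) * y ^ l * (x ^ 2 * y * (1 - x - y) - t)`. -/
noncomputable def relationIntegrand (k l : ℤ) (t : ℝ) (z : ℝ × ℝ) : ℝ :=
  ((k : ℝ) + 3) * (z.1 ^ (k + 2) * z.2 ^ (l + 1)) -
    ((k : ℝ) + 4) * (z.1 ^ (k + 3) * z.2 ^ (l + 1)) -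
    ((k : ℝ) + 3) * (z.1 ^ (k + 2) * z.2 ^ (l + 2)) -
    t * ((k : ℝ) + 1) * (z.1 ^ k * z.2 ^ l)

theorem hasDerivAt_relationIntegrand (k l : ℤ) (t : ℝ) {x y : ℝ} (hx : x ≠ 0) (hy : y ≠ 0) :
    HasDerivAt (fun x : ℝ => x ^ (k + 1) * y ^ l * (x ^ 2 * y * (1 - x - y) - t))
      (relationIntegrand k l t (x, y)) x := by
  have h1 := (hasDerivAt_zpow (k + 1) x (Or.inl hx)).mul_const (y ^ l)
  have h2 := ((((hasDerivAt_id x).pow 2).mul_const y).mul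
    (((hasDerivAt_id x).const_sub 1).sub_const y)).sub_const t
  refine (h1.mul h2).congr_deriv ?_
  simp only [relationIntegrand, id, zpow_add₀ hx, zpow_add₀ hy, add_sub_cancel_right]
  have e3 : x ^ (3 : ℤ) = x ^ 3 := by norm_cast
  have e2 : x ^ (2 : ℤ) = x ^ 2 := by norm_cast
  have f2 : y ^ (2 : ℤ) = y ^ 2 := by norm_cast
  simp only [zpow_one, e3, e2, f2]
  push_cast
  simp
  ring

theorem setIntegral_Δslice_relationIntegrand (k l : ℤ) {t : ℝ} (ht : 0 < t) (y : ℝ) :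
    ∫ x in Δslice t y, relationIntegrand k l t (x, y) = 0 := by
  rcases (Δslice t y).eq_empty_or_nonempty with he | hne
  · simp [he]
  obtain ⟨a, b, hab, hS, hat, hbt⟩ := exists_Δslice_eq_Icc ht hne
  have hy : y ≠ 0 := hne.some_mem.2.1.ne'
  have hpos : ∀ x ∈ uIcc a b, x ≠ 0 := by
    rw [uIcc_of_le hab, ← hS]
    exact fun x hx => hx.1.ne'
  have hcont : ContinuousOn (fun x => relationIntegrand k l t (x, y)) (uIcc a b) := by
    have hz : ∀ n : ℤ, ContinuousOn (fun x : ℝ => x ^ n) (uIcc a b) :=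
      fun n => continuousOn_id.zpow₀ n fun x hx => Or.inl (hpos x hx)
    have hm : ∀ (c : ℝ) (i j : ℤ), ContinuousOn (fun x : ℝ => c * (x ^ i * y ^ j)) (uIcc a b) :=
      fun c i j => ((hz i).mul continuousOn_const).const_mul c
    exact (((hm _ _ _).sub (hm _ _ _)).sub (hm _ _ _)).sub (hm _ _ _)
  rw [hS, integral_Icc_eq_integral_Ioc, ← intervalIntegral.integral_of_le hab,
    intervalIntegral.integral_eq_sub_of_hasDerivAt
      (fun x hx => hasDerivAt_relationIntegrand k l t (hpos x hx) hy) hcont.intervalIntegrable,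
    hat, hbt]
  simp

theorem setIntegral_Δset_relationIntegrand (k l : ℤ) {t : ℝ} (ht : 0 < t) :
    ∫ z in Δset t, relationIntegrand k l t z = 0 := by
  have hI := integrableOn_zpow_mul_zpow_Δset ht
  have hF : IntegrableOn (relationIntegrand k l t) (Δset t) :=
    ((((hI _ _).const_mul _).sub ((hI _ _).const_mul _)).sub ((hI _ _).const_mul _)).sub
      ((hI _ _).const_mul _)
  have hmeas : MeasurableSet (Δset t) := (isCompact_Δset ht).measurableSet
  rw [← integral_indicator hmeas, Measure.volume_eq_prod,
    integral_prod_symm _ (Measure.volume_eq_prod ℝ ℝ ▸ hF.integrable_indicator hmeas)]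
  refine integral_eq_zero_of_ae (Eventually.of_forall fun y => ?_)
  refine Eq.trans ?_ (setIntegral_Δslice_relationIntegrand k l ht y)
  rw [← integral_indicator (isCompact_Δslice ht y).measurableSet]
  rfl

/-- first relation of Lemma 2.2 specialized to `H = x²y - x³y - x²y²`. -/
theorem abelian_integral_relation_one (k l : ℤ) (t : ℝ) (ht : t ∈ Set.Ioo (0 : ℝ) (1 / 64)) :
    t * ((k : ℝ) + 1) * Iab k l t =
      ((k : ℝ) + 3) * Iab (k + 2) (l + 1) t - ((k : ℝ) + 4) * Iab (k + 3) (l + 1) t -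
        ((k : ℝ) + 3) * Iab (k + 2) (l + 2) t := by
  have hI := integrableOn_zpow_mul_zpow_Δset ht.1
  have hm : ∀ (c : ℝ) (i j : ℤ),
      Integrable (fun z : ℝ × ℝ => c * (z.1 ^ i * z.2 ^ j)) (volume.restrict (Δset t)) :=
    fun c i j => (hI i j).const_mul c
  have h := setIntegral_Δset_relationIntegrand k l ht.1
  unfold relationIntegrand at h
  rw [integral_sub (by exact ((hm _ _ _).sub (hm _ _ _)).sub (hm _ _ _)) (hm _ _ _),
    integral_sub (by exact (hm _ _ _).sub (hm _ _ _)) (hm _ _ _),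
    integral_sub (hm _ _ _) (hm _ _ _),
    integral_const_mul, integral_const_mul, integral_const_mul, integral_const_mul] at h
  unfold Iab
  linarith
end

section
/- For all integers k, l ∈ ℤ, the function t ↦ 2·I_{k+2,l+1}(t) − 3·I_{k+3,l+1}(t) − 2·I_{k+2,l+2}(t) is differentiable on (0, 1/64) and its derivative at each t ∈ (0, 1/64) equals (k+1)·I_{k,l}(t). -/
open MeasureTheory Set Filter

lemma Δset_subset_Icc {s : ℝ} (hs : 0 < s) : Δset s ⊆ Icc s 1 ×ˢ Icc s 1 := by
  rintro ⟨x, y⟩ ⟨hx, hy, h⟩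
  simp only at hx hy h
  have hw : 0 < 1 - x - y := by
    by_contra! hw
    have : x ^ 2 * y * (1 - x - y) ≤ 0 := mul_nonpos_of_nonneg_of_nonpos (by positivity) hw
    linarith
  have h1 : x * y * (1 - x - y) ≤ 1 :=
    mul_le_one₀ (mul_le_one₀ (by linarith) hy.le (by linarith)) hw.le (by linarith)
  have h2 : x ^ 2 * (1 - x - y) ≤ 1 :=
    mul_le_one₀ (pow_le_one₀ hx.le (by linarith)) hw.le (by linarith)
  refine ⟨⟨?_, ?_⟩, ⟨?_, ?_⟩⟩ <;> simp only <;> nlinarith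

lemma isClosed_Δset {s : ℝ} (hs : 0 < s) : IsClosed (Δset s) := by
  have h : Δset s = (Icc s 1 ×ˢ Icc s 1) ∩
      {z : ℝ × ℝ | s ≤ z.1 ^ 2 * z.2 * (1 - z.1 - z.2)} := by
    ext z
    refine ⟨fun hz => ⟨Δset_subset_Icc hs hz, hz.2.2⟩, fun hz => ⟨?_, ?_, hz.2⟩⟩
    · exact hs.trans_le hz.1.1.1
    · exact hs.trans_le hz.1.2.1
  rw [h]
  exact (isClosed_Icc.prod isClosed_Icc).inter (isClosed_le (by fun_prop) (by fun_prop))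

lemma isCompact_Δset_s7 {s : ℝ} (hs : 0 < s) : IsCompact (Δset s) :=
  (isCompact_Icc.prod isCompact_Icc).of_isClosed_subset (isClosed_Δset hs) (Δset_subset_Icc hs)

lemma continuousOn_monomial_Δset (i j : ℤ) (s : ℝ) :
    ContinuousOn (fun z : ℝ × ℝ => z.1 ^ i * z.2 ^ j) (Δset s) :=
  (continuousOn_fst.zpow₀ i fun _ hz => Or.inl hz.1.ne').mul
    (continuousOn_snd.zpow₀ j fun _ hz => Or.inl hz.2.1.ne')

lemma integrableOn_monomial_Δset (i j : ℤ) {s : ℝ} (hs : 0 < s) :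
    IntegrableOn (fun z : ℝ × ℝ => z.1 ^ i * z.2 ^ j) (Δset s) :=
  (continuousOn_monomial_Δset i j s).integrableOn_compact (isCompact_Δset_s7 hs)

lemma finite_setOf_eval_eq_zero {p : Polynomial ℝ} {a : ℝ} (h : p.eval a ≠ 0) :
    {x : ℝ | p.eval x = 0}.Finite :=
  Polynomial.finite_setOfPred_isRoot (p := p) fun hp => h (by simp [hp])

lemma finite_level_fst (y : ℝ) {s : ℝ} (hs : 0 < s) :
    {x : ℝ | x ^ 2 * y * (1 - x - y) = s}.Finite := by
  open Polynomial in
  refine (finite_setOf_eval_eq_zero (a := 0)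
    (p := X ^ 2 * C y * (1 - X - C y) - C s) ?_).subset fun x hx => ?_
  · simp [hs.ne']
  · simpa [sub_eq_zero, mul_comm y] using hx

lemma finite_level_snd (x : ℝ) {s : ℝ} (hs : 0 < s) :
    {y : ℝ | x ^ 2 * y * (1 - x - y) = s}.Finite := by
  open Polynomial in
  refine (finite_setOf_eval_eq_zero (a := 0)
    (p := C x ^ 2 * X * (1 - C x - X) - C s) ?_).subset fun y hy => ?_
  · simp [hs.ne']
  · simpa [sub_eq_zero] using hy

lemma ae_ne_level {s : ℝ} (hs : 0 < s) :
    ∀ᵐ z : ℝ × ℝ, z.1 ^ 2 * z.2 * (1 - z.1 - z.2) ≠ s := by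
  have hm : MeasurableSet {z : ℝ × ℝ | z.1 ^ 2 * z.2 * (1 - z.1 - z.2) = s} :=
    (isClosed_eq (by fun_prop) (by fun_prop)).measurableSet
  rw [ae_iff]
  simp only [ne_eq, not_not]
  rw [Measure.volume_eq_prod, Measure.measure_prod_null hm]
  exact Eventually.of_forall fun x => (finite_level_snd x hs).measure_zero _

/-- The `x`-derivative of `x ^ (k + 1) * y ^ l * (H - s)`, where `H = x² y (1 - x - y)`. -/
noncomputable def sliceDeriv (k l : ℤ) (s : ℝ) (z : ℝ × ℝ) : ℝ :=
  z.1 ^ (k + 1) * z.2 ^ l * (2 * z.1 * z.2 - 3 * z.1 ^ 2 * z.2 - 2 * z.1 * z.2 ^ 2) +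
    (k + 1) * (z.1 ^ k * z.2 ^ l * (z.1 ^ 2 * z.2 * (1 - z.1 - z.2) - s))

lemma continuousOn_sliceDeriv (k l : ℤ) (s : ℝ) : ContinuousOn (sliceDeriv k l s) (Δset s) :=
  ((continuousOn_monomial_Δset (k + 1) l s).mul (by fun_prop)).add
    (continuousOn_const.mul ((continuousOn_monomial_Δset k l s).mul (by fun_prop)))

lemma hasDerivAt_slice (k l : ℤ) {s x y : ℝ} (hx : 0 < x) (hy : 0 < y)
    (hne : x ^ 2 * y * (1 - x - y) ≠ s) :
    HasDerivAt (fun x : ℝ => x ^ (k + 1) * y ^ l * max (x ^ 2 * y * (1 - x - y) - s) 0)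
      ((Δset s).indicator (sliceDeriv k l s) (x, y)) x := by
  have hc : ContinuousAt (fun x : ℝ => x ^ 2 * y * (1 - x - y)) x := by fun_prop
  rcases hne.lt_or_gt with h | h
  · rw [indicator_of_notMem fun hz => absurd hz.2.2 (not_le.2 h)]
    refine (hasDerivAt_const x (0 : ℝ)).congr_of_eventuallyEq ?_
    filter_upwards [hc.eventually_lt_const h] with w hw
    rw [max_eq_right (by linarith), mul_zero]
  · rw [indicator_of_mem (show (x, y) ∈ Δset s from ⟨hx, hy, h.le⟩)]
    have h1 := (hasDerivAt_zpow (k + 1) x (Or.inl hx.ne')).mul_const (y ^ l)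
    have h2 : HasDerivAt (fun x : ℝ => x ^ 2 * y * (1 - x - y) - s)
        (2 * x * y - 3 * x ^ 2 * y - 2 * x * y ^ 2) x := by
      have := ((((hasDerivAt_id x).pow 2).mul_const y).mul
        (((hasDerivAt_id x).const_sub 1).sub_const y)).sub_const s
      refine this.congr_deriv ?_
      simp
      ring
    refine ((h1.mul h2).congr_of_eventuallyEq ?_).congr_deriv ?_
    · filter_upwards [hc.eventually_const_lt h] with w hw
      simp only [Pi.mul_apply]
      rw [max_eq_left (by linarith)]
    · simp only [sliceDeriv, add_sub_cancel_right]
      push_cast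
      ring

lemma integral_slice_eq_zero (k l : ℤ) {s : ℝ} (hs : 0 < s) (y : ℝ) :
    ∫ x, (Δset s).indicator (sliceDeriv k l s) (x, y) = 0 := by
  rcases le_or_gt y 0 with hy | hy
  · have : ∀ x, (Δset s).indicator (sliceDeriv k l s) (x, y) = 0 := fun x =>
      indicator_of_notMem (fun hz => absurd hz.2.1 (not_lt.2 hy)) _
    simp [this]
  set D : Set ℝ := {x | (x, y) ∈ Δset s}
  have hD : IsCompact D := isCompact_Icc.of_isClosed_subset
    ((isClosed_Δset hs).preimage (by fun_prop)) fun x hx => (Δset_subset_Icc hs hx).1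
  have hf : (fun x => (Δset s).indicator (sliceDeriv k l s) (x, y)) =
      D.indicator fun x => sliceDeriv k l s (x, y) := rfl
  have hint : Integrable (fun x => (Δset s).indicator (sliceDeriv k l s) (x, y)) := by
    rw [hf, integrable_indicator_iff hD.measurableSet]
    have hc : ContinuousOn (fun x : ℝ => (x, y)) D := by fun_prop
    exact ((continuousOn_sliceDeriv k l s).comp hc fun x hx => hx).integrableOn_compact hD
  have hsupp : Function.support (fun x => (Δset s).indicator (sliceDeriv k l s) (x, y)) ⊆
      Ioc (s / 2) (s + 1) := by
    intro x hx
    have hz : x ∈ Icc s 1 := (Δset_subset_Icc hs (mem_of_indicator_ne_zero hx)).1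
    exact ⟨by linarith [hz.1], by linarith [hz.2]⟩
  have hzero : ∀ x, 0 < x → (x < s ∨ 1 < x) →
      x ^ (k + 1) * y ^ l * max (x ^ 2 * y * (1 - x - y) - s) 0 = 0 := by
    intro x hx h
    have hn : (x, y) ∉ Δset s := fun hz => by
      have := (Δset_subset_Icc hs hz).1
      rcases h with h | h
      · exact absurd this.1 (not_le.2 h)
      · exact absurd this.2 (not_le.2 h)
    have : x ^ 2 * y * (1 - x - y) < s := not_le.1 fun h => hn ⟨hx, hy, h⟩
    rw [max_eq_right (by linarith), mul_zero]
  have hle : s / 2 ≤ s + 1 := by linarith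
  rw [← intervalIntegral.integral_eq_integral_of_support_subset hsupp,
    integral_eq_of_hasDerivAt_off_countable_of_le
      (fun x : ℝ => x ^ (k + 1) * y ^ l * max (x ^ 2 * y * (1 - x - y) - s) 0) _ hle
      (finite_level_fst y hs).countable ?_ ?_ hint.intervalIntegrable,
    hzero _ (by linarith) (Or.inr (by linarith)), hzero _ (by linarith) (Or.inl (by linarith)),
    sub_zero]
  · refine ContinuousOn.mul (ContinuousOn.mul (continuousOn_id.zpow₀ _ fun x hx => Or.inl ?_)
      continuousOn_const) (by fun_prop)
    have := hx.1
    simp only [id]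
    linarith
  · exact fun x hx => hasDerivAt_slice k l (by linarith [hx.1.1]) hy hx.2

lemma integral_sliceDeriv_eq_zero (k l : ℤ) {s : ℝ} (hs : 0 < s) :
    ∫ z in Δset s, sliceDeriv k l s z = 0 := by
  have hm := (isClosed_Δset hs).measurableSet
  rw [← integral_indicator hm, Measure.volume_eq_prod, integral_prod_symm]
  · simp [integral_slice_eq_zero k l hs]
  · rw [← Measure.volume_eq_prod, integrable_indicator_iff hm]
    exact (continuousOn_sliceDeriv k l s).integrableOn_compact (isCompact_Δset_s7 hs)

lemma combination_eq_integral (k l : ℤ) {s : ℝ} (hs : 0 < s) :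
    2 * Iab (k + 2) (l + 1) s - 3 * Iab (k + 3) (l + 1) s - 2 * Iab (k + 2) (l + 2) s =
      -(k + 1) * ∫ z in Δset s, z.1 ^ k * z.2 ^ l * (z.1 ^ 2 * z.2 * (1 - z.1 - z.2) - s) := by
  have hi (i j : ℤ) := integrableOn_monomial_Δset i j hs
  have hB : IntegrableOn (fun z : ℝ × ℝ =>
      z.1 ^ k * z.2 ^ l * (z.1 ^ 2 * z.2 * (1 - z.1 - z.2) - s)) (Δset s) :=
    ((continuousOn_monomial_Δset k l s).mul (by fun_prop)).integrableOn_compact (isCompact_Δset_s7 hs)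
  have h : ∫ z in Δset s, sliceDeriv k l s z = ∫ z in Δset s,
      ((2 * (z.1 ^ (k + 2) * z.2 ^ (l + 1)) - 3 * (z.1 ^ (k + 3) * z.2 ^ (l + 1)) -
        2 * (z.1 ^ (k + 2) * z.2 ^ (l + 2))) +
      (k + 1) * (z.1 ^ k * z.2 ^ l * (z.1 ^ 2 * z.2 * (1 - z.1 - z.2) - s))) := by
    refine setIntegral_congr_fun (isClosed_Δset hs).measurableSet fun z hz => ?_
    have hx := hz.1.ne'
    have hy := hz.2.1.ne'
    simp only [sliceDeriv, zpow_add₀ hx, zpow_add₀ hy, zpow_ofNat]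
    ring
  have h₂ : IntegrableOn (fun z : ℝ × ℝ => 2 * (z.1 ^ (k + 2) * z.2 ^ (l + 1)) -
      3 * (z.1 ^ (k + 3) * z.2 ^ (l + 1))) (Δset s) :=
    ((hi _ _).const_mul 2).sub ((hi _ _).const_mul 3)
  have h₃ : IntegrableOn (fun z : ℝ × ℝ => 2 * (z.1 ^ (k + 2) * z.2 ^ (l + 1)) -
      3 * (z.1 ^ (k + 3) * z.2 ^ (l + 1)) - 2 * (z.1 ^ (k + 2) * z.2 ^ (l + 2))) (Δset s) :=
    h₂.sub ((hi _ _).const_mul 2)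
  rw [integral_sliceDeriv_eq_zero k l hs, integral_add h₃ (hB.const_mul _),
    integral_sub h₂ ((hi _ _).const_mul 2),
    integral_sub ((hi _ _).const_mul 2) ((hi _ _).const_mul 3),
    integral_const_mul, integral_const_mul, integral_const_mul, integral_const_mul] at h
  simp only [Iab]
  linarith

lemma Δset_subset_Δset {s t : ℝ} (h : s ≤ t) : Δset t ⊆ Δset s :=
  fun _ hz => ⟨hz.1, hz.2.1, h.trans hz.2.2⟩

lemma setIntegral_eq_setIntegral_max (k l : ℤ) {r s : ℝ} (hr : 0 < r) (hrs : r ≤ s) :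
    ∫ z in Δset s, z.1 ^ k * z.2 ^ l * (z.1 ^ 2 * z.2 * (1 - z.1 - z.2) - s) =
      ∫ z in Δset r, z.1 ^ k * z.2 ^ l * max (z.1 ^ 2 * z.2 * (1 - z.1 - z.2) - s) 0 := by
  have hr' := (isClosed_Δset hr).measurableSet
  refine Eq.trans ?_ (setIntegral_eq_of_subset_of_forall_sdiff_eq_zero hr'
    (Δset_subset_Δset hrs) ?_).symm
  · refine setIntegral_congr_fun (isClosed_Δset (hr.trans_le hrs)).measurableSet fun z hz => ?_
    rw [max_eq_left (sub_nonneg.2 hz.2.2)]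
  · intro z hz
    have : ¬ s ≤ z.1 ^ 2 * z.2 * (1 - z.1 - z.2) := fun h => hz.2 ⟨hz.1.1, hz.1.2.1, h⟩
    rw [max_eq_right (by linarith), mul_zero]

lemma hasDerivAt_max_sub {h t : ℝ} (hne : h ≠ t) :
    HasDerivAt (fun s : ℝ => max (h - s) 0) (if t ≤ h then -1 else 0) t := by
  rcases hne.lt_or_gt with hlt | hlt
  · rw [if_neg (not_le.2 hlt)]
    refine (hasDerivAt_const t (0 : ℝ)).congr_of_eventuallyEq ?_
    filter_upwards [lt_mem_nhds hlt] with s hs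
    exact max_eq_right (by linarith)
  · rw [if_pos hlt.le]
    refine ((hasDerivAt_id t).const_sub h).congr_of_eventuallyEq ?_
    filter_upwards [gt_mem_nhds hlt] with s hs
    exact max_eq_left (by linarith)

lemma hasDerivAt_setIntegral_max (k l : ℤ) {r t : ℝ} (hr : 0 < r) (hrt : r ≤ t) :
    HasDerivAt (fun s : ℝ => ∫ z in Δset r,
      z.1 ^ k * z.2 ^ l * max (z.1 ^ 2 * z.2 * (1 - z.1 - z.2) - s) 0) (-Iab k l t) t := by
  have hmr := (isClosed_Δset hr).measurableSet
  have hmt := (isClosed_Δset (hr.trans_le hrt)).measurableSet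
  have hF (s : ℝ) : IntegrableOn (fun z : ℝ × ℝ =>
      z.1 ^ k * z.2 ^ l * max (z.1 ^ 2 * z.2 * (1 - z.1 - z.2) - s) 0) (Δset r) :=
    ((continuousOn_monomial_Δset k l r).mul (by fun_prop)).integrableOn_compact (isCompact_Δset_s7 hr)
  have hM := integrableOn_monomial_Δset k l hr
  have key := hasDerivAt_integral_of_dominated_loc_of_lip (μ := volume.restrict (Δset r))
    (F := fun (s : ℝ) (z : ℝ × ℝ) =>
      z.1 ^ k * z.2 ^ l * max (z.1 ^ 2 * z.2 * (1 - z.1 - z.2) - s) 0)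
    (F' := fun z => -(Δset t).indicator (fun z : ℝ × ℝ => z.1 ^ k * z.2 ^ l) z)
    (bound := fun z => z.1 ^ k * z.2 ^ l) (x₀ := t) (s := univ) univ_mem
    (Eventually.of_forall fun s => (hF s).aestronglyMeasurable) (hF t)
    (hM.indicator hmt).neg.aestronglyMeasurable ?_ hM ?_
  · refine key.2.congr_deriv ?_
    rw [integral_neg, setIntegral_indicator hmt, inter_eq_right.2 (Δset_subset_Δset hrt), Iab]
  · refine Eventually.of_forall fun z => LipschitzOnWith.of_dist_le_mul fun a _ b _ => ?_
    rw [Real.dist_eq, Real.dist_eq, ← mul_sub, abs_mul, Real.coe_nnabs]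
    refine mul_le_mul_of_nonneg_left ?_ (abs_nonneg _)
    refine (abs_max_sub_max_le_abs _ _ _).trans_eq ?_
    rw [sub_sub_sub_cancel_left, abs_sub_comm]
  · filter_upwards [ae_restrict_mem hmr, ae_restrict_of_ae (ae_ne_level (hr.trans_le hrt))]
      with z hz hne
    refine ((hasDerivAt_max_sub hne).const_mul _).congr_deriv ?_
    by_cases h : t ≤ z.1 ^ 2 * z.2 * (1 - z.1 - z.2)
    · rw [if_pos h, indicator_of_mem (show z ∈ Δset t from ⟨hz.1, hz.2.1, h⟩), mul_neg_one]
    · rw [if_neg h, indicator_of_notMem fun hz => h hz.2.2, mul_zero, neg_zero]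

/-- third relation of Lemma 2.2 (Gelfand–Leray) specialized to `H`. -/
theorem abelian_integral_relation_three (k l : ℤ) (t : ℝ)
    (ht : t ∈ Set.Ioo (0 : ℝ) (1 / 64)) :
    HasDerivAt
      (fun s : ℝ =>
        2 * Iab (k + 2) (l + 1) s - 3 * Iab (k + 3) (l + 1) s - 2 * Iab (k + 2) (l + 2) s)
      (((k : ℝ) + 1) * Iab k l t) t := by
  have hr : 0 < t / 2 := half_pos ht.1
  have hrt : t / 2 < t := half_lt_self ht.1
  refine (((hasDerivAt_setIntegral_max k l hr hrt.le).const_mul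
    (-((k : ℝ) + 1))).congr_of_eventuallyEq ?_).congr_deriv (by ring)
  filter_upwards [lt_mem_nhds hrt] with s hs
  rw [combination_eq_integral k l (hr.trans hs), setIntegral_eq_setIntegral_max k l hr hs.le]
end
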